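/- arXiv:1611.00479 — 3 statements merged into one kernel-verified Lean document; each statement's English description precedes it below -/
import Mathlib

section
/- Let N ≥ 2 and let V be a unitary on ℂ^N ⊗ ℂ^N. If e_p(V²) < e_p(V)·(2 − e_p(V)/ē_p), where ē_p = (N−1)²/(N²+1), then there exist unitaries U^A, U^B on ℂ^N such that e_p(V²) < e_p(V·(U^A ⊗ U^B)·V). In particular, local operators can strictly increase the entangling power of the squared gate. -/
open Matrix MeasureTheory
open scoped Kronecker

noncomputable section

instance {m n R : Type*} [TopologicalSpace R] : MeasurableSpace (Matrix m n R) := borel _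
instance {m n R : Type*} [TopologicalSpace R] : BorelSpace (Matrix m n R) := ⟨rfl⟩

/-- Reshuffling: `(U_R)_{(i,j),(α,β)} = U_{(i,α),(j,β)}`. -/
def reshuffle (N : ℕ) (U : Matrix (Fin N × Fin N) (Fin N × Fin N) ℂ) :
    Matrix (Fin N × Fin N) (Fin N × Fin N) ℂ :=
  Matrix.of fun p q => U (p.1, q.1) (p.2, q.2)

/-- Partial transpose: `(U_Γ)_{(j,α),(i,β)} = U_{(i,α),(j,β)}`. -/
def ptransp (N : ℕ) (U : Matrix (Fin N × Fin N) (Fin N × Fin N) ℂ) :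
    Matrix (Fin N × Fin N) (Fin N × Fin N) ℂ :=
  Matrix.of fun p q => U (q.1, p.2) (p.1, q.2)

/-- The swap gate `S(x ⊗ y) = y ⊗ x`. -/
def swapGate (N : ℕ) : Matrix (Fin N × Fin N) (Fin N × Fin N) ℂ :=
  Matrix.of fun p q => if p.1 = q.2 ∧ p.2 = q.1 then 1 else 0

/-- `ρ_R(U) = U_R U_R† / N²`. -/
def rhoR (N : ℕ) (U : Matrix (Fin N × Fin N) (Fin N × Fin N) ℂ) :
    Matrix (Fin N × Fin N) (Fin N × Fin N) ℂ :=
  ((N : ℂ) ^ 2)⁻¹ • (reshuffle N U * (reshuffle N U)ᴴ)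

/-- `ρ_T(U) = S U_Γ U_Γ† S / N²`. -/
def rhoT (N : ℕ) (U : Matrix (Fin N × Fin N) (Fin N × Fin N) ℂ) :
    Matrix (Fin N × Fin N) (Fin N × Fin N) ℂ :=
  ((N : ℂ) ^ 2)⁻¹ • (swapGate N * (ptransp N U * (ptransp N U)ᴴ) * swapGate N)

/-- Purity `X(U) = tr(ρ_R(U)²)` (a real number). -/
def Xpur (N : ℕ) (U : Matrix (Fin N × Fin N) (Fin N × Fin N) ℂ) : ℝ :=
  ((rhoR N U * rhoR N U).trace).re

/-- Purity `Y(U) = tr(ρ_T(U)²)` (a real number). -/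
def Ypur (N : ℕ) (U : Matrix (Fin N × Fin N) (Fin N × Fin N) ℂ) : ℝ :=
  ((rhoT N U * rhoT N U).trace).re

/-- Entangling power `e_p(U)`. -/
def ep (N : ℕ) (U : Matrix (Fin N × Fin N) (Fin N × Fin N) ℂ) : ℝ :=
  ((N : ℝ) ^ 2 / ((N : ℝ) + 1) ^ 2) *
    ((1 - Xpur N U) + (1 - Ypur N U) - ((N : ℝ) ^ 2 - 1) / (N : ℝ) ^ 2)

/-- Gate typicality `g_t(U)`. -/
def gateTyp (N : ℕ) (U : Matrix (Fin N × Fin N) (Fin N × Fin N) ℂ) : ℝ :=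
  ((N : ℝ) ^ 2 / ((N : ℝ) ^ 2 - 1)) *
    (Ypur N U - Xpur N U + ((N : ℝ) ^ 2 - 1) / (N : ℝ) ^ 2)

/-- Mean entangling power over the Haar measure, `ē_p = (N-1)²/(N²+1)`. -/
def epBar (N : ℕ) : ℝ := ((N : ℝ) - 1) ^ 2 / ((N : ℝ) ^ 2 + 1)

/-- `iterGate U W k = U · W_{k-1} · U ⋯ W_0 · U`, i.e. `U^(k+1)` with `k` interlacing
local gates `W_0, …, W_{k-1}`. -/
def iterGate {D : Type*} [Fintype D] [DecidableEq D] (U : Matrix D D ℂ)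
    (W : ℕ → Matrix D D ℂ) : ℕ → Matrix D D ℂ
  | 0 => U
  | k + 1 => U * W k * iterGate U W k

/-- A semigroup of linear isometries of a finite-dimensional real inner product space has a fixed
point in the closed convex hull of every orbit, expressed through linear functionals. -/
lemma exists_fixed_point_of_isometries {E ι : Type*} [NormedAddCommGroup E]
    [InnerProductSpace ℝ E] [FiniteDimensional ℝ E] [Nonempty ι] (ρ : ι → E →ₗ[ℝ] E)
    (hmul : ∀ g h, ∃ k, ∀ x, ρ g (ρ h x) = ρ k x) (hnorm : ∀ g x, ‖ρ g x‖ = ‖x‖) (x : E) :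
    ∃ p, (∀ g, ρ g p = p) ∧
      ∀ (φ : E →ₗ[ℝ] ℝ) (c : ℝ), (∀ g, φ (ρ g x) ≤ c) → φ p ≤ c := by
  set K : Set E := closure (convexHull ℝ (Set.range fun g => ρ g x)) with hK
  have hconv : Convex ℝ K := (convex_convexHull ℝ _).closure
  have hne : K.Nonempty := (Set.range_nonempty _).convexHull.closure
  obtain ⟨p, hpK, hp⟩ := exists_norm_eq_iInf_of_complete_convex hne
    isClosed_closure.isComplete hconv 0
  rw [norm_eq_iInf_iff_real_inner_le_zero hconv hpK] at hp
  have hmin : ∀ S : Set E, IsClosed S → Convex ℝ S → (∀ g, ρ g x ∈ S) → K ⊆ S :=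
    fun S hS hS' h => closure_minimal (convexHull_min (Set.range_subset_iff.2 h) hS') hS
  refine ⟨p, fun g => ?_, fun φ c h => ?_⟩
  · have hgp : ρ g p ∈ K := by
      refine hmin (ρ g ⁻¹' K)
        (isClosed_closure.preimage (ρ g).continuous_of_finiteDimensional)
        (hconv.linear_preimage (ρ g)) (fun h => ?_) hpK
      obtain ⟨k, hk⟩ := hmul g h
      rw [Set.mem_preimage, hk]
      exact subset_closure (subset_convexHull ℝ _ ⟨k, rfl⟩)
    have h1 := hp _ hgp
    rw [zero_sub, inner_neg_left, inner_sub_right, real_inner_self_eq_norm_sq] at h1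
    have h2 := norm_sub_sq_real (ρ g p) p
    rw [hnorm, real_inner_comm] at h2
    have h3 : ‖ρ g p - p‖ ^ 2 = 0 := le_antisymm (by linarith) (sq_nonneg _)
    exact sub_eq_zero.1 (norm_eq_zero.1 (pow_eq_zero_iff two_ne_zero |>.1 h3))
  · exact hmin {y | φ y ≤ c} (isClosed_le φ.continuous_of_finiteDimensional continuous_const)
      (convex_halfSpace_le φ.isLinear c) h hpK

open scoped ComplexOrder in
/-- Averaging over conjugation by a semigroup of unitaries, expressed through linear functionals. -/
lemma exists_unitary_twirl {J ι : Type*} [Fintype J] [DecidableEq J] [Nonempty ι]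
    (L : ι → Matrix J J ℂ) (hL : ∀ g, L g ∈ unitaryGroup J ℂ)
    (hmul : ∀ g h, ∃ k, L g * L h = L k) (M : Matrix J J ℂ) :
    ∃ P, (∀ g, L g * P = P * L g) ∧
      ∀ (φ : Matrix J J ℂ →ₗ[ℝ] ℝ) (c : ℝ),
        (∀ g, φ (L g * M * (L g)ᴴ) ≤ c) → φ P ≤ c := by
  let := Matrix.toMatrixNormedAddCommGroup (1 : Matrix J J ℂ) PosDef.one
  let : InnerProductSpace ℂ (Matrix J J ℂ) :=
    Matrix.toMatrixInnerProductSpace (1 : Matrix J J ℂ) PosDef.one.posSemidef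
  let : InnerProductSpace ℝ (Matrix J J ℂ) := InnerProductSpace.rclikeToReal ℂ _
  have hL' : ∀ g, (L g)ᴴ * L g = 1 := fun g => (mem_unitaryGroup_iff').1 (hL g)
  let ρ : ι → Matrix J J ℂ →ₗ[ℝ] Matrix J J ℂ := fun g =>
    LinearMap.mulLeft ℝ (L g) ∘ₗ LinearMap.mulRight ℝ (L g)ᴴ
  have hρ : ∀ g X, ρ g X = L g * X * (L g)ᴴ := fun g X => (mul_assoc _ _ _).symm
  obtain ⟨P, hP, hφ⟩ := exists_fixed_point_of_isometries ρ (fun g h => by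
      obtain ⟨k, hk⟩ := hmul g h
      refine ⟨k, fun X => ?_⟩
      simp only [hρ, ← hk, conjTranspose_mul, mul_assoc]) (fun g X => by
      have key : inner ℂ (ρ g X) (ρ g X) = inner ℂ X X := by
        change ((ρ g X) * 1 * (ρ g X)ᴴ).trace = (X * 1 * Xᴴ).trace
        rw [hρ, mul_one, mul_one, conjTranspose_mul, conjTranspose_mul, conjTranspose_conjTranspose]
        calc _ = (L g * (X * ((L g)ᴴ * L g) * Xᴴ) * (L g)ᴴ).trace := by simp only [mul_assoc]
          _ = _ := by rw [trace_mul_comm, ← mul_assoc, hL', mul_one, one_mul]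
      rw [@norm_eq_sqrt_re_inner ℂ, key, ← @norm_eq_sqrt_re_inner ℂ]) M
  refine ⟨P, fun g => ?_, fun φ c h => hφ φ c fun g => by rw [hρ]; exact h g⟩
  calc L g * P = L g * P * ((L g)ᴴ * L g) := by rw [hL', mul_one]
    _ = ρ g P * L g := by rw [hρ]; simp only [mul_assoc]
    _ = P * L g := by rw [hP]

/-- The commutant of the two-fold tensor power of the unitary group, in coordinates. -/
lemma commutant_tensor_sq {n : Type*} [Fintype n] [DecidableEq n] (q : n → n → n → n → ℂ)
    (h : ∀ u ∈ unitaryGroup n ℂ, ∀ a b c d,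
      ∑ x, ∑ y, q a b x y * (u x c * u y d) = ∑ x, ∑ y, u a x * u b y * q x y c d)
    {x₀ x₁ : n} (hx : x₀ ≠ x₁) (a b c d : n) :
    q a b c d = q x₀ x₁ x₀ x₁ * (if a = c ∧ b = d then 1 else 0) +
      q x₀ x₁ x₁ x₀ * (if a = d ∧ b = c then 1 else 0) := by
  have hdiag : ∀ a b c d, q a b c d ≠ 0 → (a = c ∧ b = d) ∨ (a = d ∧ b = c) := by
    intro a b c d hq
    have key : ∀ k, (if c = k then Complex.I else 1) * (if d = k then Complex.I else 1) =
        (if a = k then Complex.I else 1) * (if b = k then Complex.I else 1) := by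
      intro k
      have hu : diagonal (fun i => if i = k then Complex.I else 1) ∈ unitaryGroup n ℂ := by
        rw [mem_unitaryGroup_iff, star_eq_conjTranspose, diagonal_conjTranspose,
          diagonal_mul_diagonal, ← diagonal_one]
        congr 1
        funext i
        by_cases hi : i = k <;> simp [hi]
      have := h _ hu a b c d
      simp only [diagonal_apply, ite_mul, mul_ite, zero_mul, mul_zero, Finset.sum_ite_eq,
        Finset.sum_ite_eq', Finset.mem_univ, if_true] at this
      apply mul_left_cancel₀ hq
      rw [mul_comm _ (_ * _ : ℂ), mul_comm _ (_ * _ : ℂ)]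
      simpa [mul_comm] using this
    have h1 := key a
    have h2 := key b
    have hI : Complex.I ≠ 1 := fun hI => by simpa using congrArg Complex.im hI
    have hI' : (1 : ℂ) ≠ -1 := by norm_num
    have hI'' : Complex.I ≠ -1 := fun hI => by simpa using congrArg Complex.im hI
    grind [Complex.I_mul_I]
  have hzero : ∀ a b c d, ¬ ((a = c ∧ b = d) ∨ (a = d ∧ b = c)) → q a b c d = 0 :=
    fun a b c d => fun h => by_contra fun h' => h (hdiag a b c d h')
  have hperm : ∀ (σ : Equiv.Perm n) a b c d, q (σ a) (σ b) (σ c) (σ d) = q a b c d := by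
    intro σ a b c d
    have hu : (of fun i j => if i = σ j then (1 : ℂ) else 0) ∈ unitaryGroup n ℂ := by
      rw [mem_unitaryGroup_iff']
      ext i j
      simp [mul_apply, star_apply, one_apply, eq_comm]
    have := h _ hu (σ a) (σ b) c d
    simpa using this
  have hα : ∀ a b, a ≠ b → q a b a b = q x₀ x₁ x₀ x₁ ∧ q a b b a = q x₀ x₁ x₁ x₀ := by
    intro a b hab
    let τ := Equiv.swap x₀ a
    have e0 : (Equiv.swap (τ x₁) b * τ) x₀ = a := by
      have : a ≠ τ x₁ := fun h => hx (τ.injective (by rw [← h]; simp [τ]))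
      rw [Equiv.Perm.mul_apply, Equiv.swap_apply_left, Equiv.swap_apply_of_ne_of_ne this hab]
    have e1 : (Equiv.swap (τ x₁) b * τ) x₁ = b := by
      rw [Equiv.Perm.mul_apply, Equiv.swap_apply_left]
    have h1 := hperm (Equiv.swap (τ x₁) b * τ) x₀ x₁ x₀ x₁
    have h2 := hperm (Equiv.swap (τ x₁) b * τ) x₀ x₁ x₁ x₀
    rw [e0, e1] at h1 h2
    exact ⟨h1, h2⟩
  have hγ : ∀ a, q a a a a = q x₀ x₁ x₀ x₁ + q x₀ x₁ x₁ x₀ := by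
    intro a
    obtain ⟨b, hab⟩ : ∃ b, a ≠ b := by
      by_cases ha : a = x₀
      · exact ⟨x₁, ha ▸ hx⟩
      · exact ⟨x₀, ha⟩
    let v : n → ℂ := fun i => if i = a then 3 / 5 else if i = b then 4 / 5 else 0
    have hv : ∑ i, v i * v i = 1 := by
      rw [Finset.sum_eq_add a b hab] <;> simp +contextual [v, hab.symm]
      norm_num
    have hvs : ∀ i, star (v i) = v i := by
      intro i
      simp only [v]
      split_ifs <;> simp
    let u : Matrix n n ℂ := 1 - (2 : ℂ) • vecMulVec v v
    have hvv : vecMulVec v v * vecMulVec v v = vecMulVec v v := by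
      ext i j
      simp only [mul_apply, vecMulVec_apply]
      calc _ = v i * (∑ k, v k * v k) * v j := by
            rw [Finset.mul_sum, Finset.sum_mul]
            exact Finset.sum_congr rfl fun k _ => by ring
        _ = _ := by rw [hv, mul_one]
    have hu : u ∈ unitaryGroup n ℂ := by
      rw [mem_unitaryGroup_iff]
      have : star u = u := by
        ext i j
        simp [u, star_apply, vecMulVec_apply, one_apply, eq_comm, hvs, mul_comm]
      rw [this]
      simp only [u, mul_sub, sub_mul, mul_one, one_mul, Matrix.mul_smul, Matrix.smul_mul, hvv]
      module
    have haa : u a a = 7 / 25 := by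
      simp [u, v, vecMulVec_apply]; norm_num
    have hab' : u a b = -24 / 25 := by
      simp [u, v, vecMulVec_apply, hab, hab.symm]; norm_num
    have := h u hu a a a b
    clear_value u
    have hl : ∑ x, ∑ y, q a a x y * (u x a * u y b) = q a a a a * (u a a * u a b) := by
      rw [Finset.sum_eq_single a, Finset.sum_eq_single a]
      · intro y _ hy
        rw [hzero a a a y (by tauto), zero_mul]
      · simp
      · intro x _ hx
        refine Finset.sum_eq_zero fun y _ => ?_
        rw [hzero a a x y (by tauto), zero_mul]
      · simp
    have hr : ∑ x, ∑ y, u a x * u a y * q x y a b =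
        u a a * u a b * q a b a b + u a b * u a a * q b a a b := by
      rw [Finset.sum_eq_add a b hab, Finset.sum_eq_single b, Finset.sum_eq_single a]
      · intro y _ hy
        rw [hzero b y a b (by tauto), mul_zero]
      · simp
      · intro y _ hy
        rw [hzero a y a b (by tauto), mul_zero]
      · simp
      · intro x _ hx
        refine Finset.sum_eq_zero fun y _ => ?_
        rw [hzero x y a b (by tauto), mul_zero]
      · simp
      · simp
    rw [hl, hr, haa, hab', (hα a b hab).1, (hα b a hab.symm).2] at this
    linear_combination (-625 / 168) * this
  by_cases hz : q a b c d = 0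
  · by_cases h1 : a = c ∧ b = d
    · obtain ⟨rfl, rfl⟩ := h1
      by_cases hab : a = b
      · subst hab; simp [hγ]
      · simp [hab, (hα a b hab).1]
    · by_cases h2 : a = d ∧ b = c
      · obtain ⟨rfl, rfl⟩ := h2
        have hab : a ≠ b := fun h => h1 ⟨h, h.symm⟩
        simp [hab, (hα a b hab).2]
      · simp [h1, h2, hz]
  · rcases hdiag _ _ _ _ hz with ⟨rfl, rfl⟩ | ⟨rfl, rfl⟩
    · by_cases hab : a = b
      · subst hab; simp [hγ]
      · simp [hab, (hα a b hab).1]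
    · by_cases hab : a = b
      · subst hab; simp [hγ]
      · simp [hab, (hα a b hab).2]

/-- Exchange of the first tensor factors of two copies of a bipartite system. -/
def exchangeFst (N : ℕ) : Equiv.Perm ((Fin N × Fin N) × (Fin N × Fin N)) where
  toFun p := ((p.2.1, p.1.2), (p.1.1, p.2.2))
  invFun p := ((p.2.1, p.1.2), (p.1.1, p.2.2))
  left_inv _ := rfl
  right_inv _ := rfl

/-- Exchange of the second tensor factors of two copies of a bipartite system. -/
def exchangeSnd (N : ℕ) : Equiv.Perm ((Fin N × Fin N) × (Fin N × Fin N)) where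
  toFun p := ((p.1.1, p.2.2), (p.2.1, p.1.2))
  invFun p := ((p.1.1, p.2.2), (p.2.1, p.1.2))
  left_inv _ := rfl
  right_inv _ := rfl

/-- The operator exchanging the first tensor factors of two copies. -/
def swapFst (N : ℕ) :
    Matrix ((Fin N × Fin N) × (Fin N × Fin N)) ((Fin N × Fin N) × (Fin N × Fin N)) ℂ :=
  (exchangeFst N).permMatrix ℂ

/-- The operator exchanging the second tensor factors of two copies. -/
def swapSnd (N : ℕ) :
    Matrix ((Fin N × Fin N) × (Fin N × Fin N)) ((Fin N × Fin N) × (Fin N × Fin N)) ℂ :=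
  (exchangeSnd N).permMatrix ℂ

section swap

variable (N : ℕ) (M : Matrix ((Fin N × Fin N) × (Fin N × Fin N))
  ((Fin N × Fin N) × (Fin N × Fin N)) ℂ)

lemma swapFst_mul : swapFst N * M = M.submatrix (exchangeFst N) id :=
  PEquiv.toMatrix_toPEquiv_mul _ _

lemma mul_swapFst : M * swapFst N = M.submatrix id (exchangeFst N) :=
  PEquiv.mul_toMatrix_toPEquiv _ _

lemma swapSnd_mul : swapSnd N * M = M.submatrix (exchangeSnd N) id :=
  PEquiv.toMatrix_toPEquiv_mul _ _

lemma mul_swapSnd : M * swapSnd N = M.submatrix id (exchangeSnd N) :=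
  PEquiv.mul_toMatrix_toPEquiv _ _

lemma swapFst_apply (p q) : swapFst N p q = if exchangeFst N p = q then 1 else 0 := by
  rw [← mul_one (swapFst N), swapFst_mul, submatrix_apply, one_apply, id]

lemma swapSnd_apply (p q) : swapSnd N p q = if exchangeSnd N p = q then 1 else 0 := by
  rw [← mul_one (swapSnd N), swapSnd_mul, submatrix_apply, one_apply, id]

lemma swapFst_mul_self : swapFst N * swapFst N = 1 := by
  rw [swapFst, ← permMatrix_mul]
  exact permMatrix_one

lemma swapSnd_mul_self : swapSnd N * swapSnd N = 1 := by
  rw [swapSnd, ← permMatrix_mul]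
  exact permMatrix_one

lemma swapFst_mul_swapSnd_comm : swapFst N * swapSnd N = swapSnd N * swapFst N := by
  rw [swapFst, swapSnd, ← permMatrix_mul, ← permMatrix_mul]
  rfl

lemma conjTranspose_swapFst : (swapFst N)ᴴ = swapFst N := by
  rw [swapFst, conjTranspose_permMatrix]
  rfl

lemma conjTranspose_swapSnd : (swapSnd N)ᴴ = swapSnd N := by
  rw [swapSnd, conjTranspose_permMatrix]
  rfl

lemma trace_swapFst : (swapFst N).trace = (N : ℂ) ^ 3 := by
  simp only [trace, diag_apply, swapFst_apply, exchangeFst, Equiv.coe_fn_mk,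
    Fintype.sum_prod_type, Prod.mk.injEq]
  simp [ite_and]
  ring

lemma trace_swapSnd : (swapSnd N).trace = (N : ℂ) ^ 3 := by
  simp only [trace, diag_apply, swapSnd_apply, exchangeSnd, Equiv.coe_fn_mk,
    Fintype.sum_prod_type, Prod.mk.injEq]
  simp [ite_and]
  ring

lemma trace_swapFst_mul_swapSnd : (swapFst N * swapSnd N).trace = (N : ℂ) ^ 2 := by
  simp only [trace, diag_apply, swapFst_mul, submatrix_apply, swapSnd_apply, exchangeFst,
    exchangeSnd, Equiv.coe_fn_mk, Fintype.sum_prod_type, Prod.mk.injEq, id]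
  simp [ite_and]
  ring

variable {N}

lemma kronecker_self_mul_swap (U : Matrix (Fin N × Fin N) (Fin N × Fin N) ℂ) :
    (U ⊗ₖ U) * (swapFst N * swapSnd N) = swapFst N * swapSnd N * (U ⊗ₖ U) := by
  rw [← mul_assoc, mul_swapFst, mul_swapSnd, mul_assoc, swapSnd_mul, swapFst_mul]
  ext p q
  simp [exchangeFst, exchangeSnd, kroneckerMap_apply, mul_comm]

lemma kronecker_local_mul_swapFst (u v : Matrix (Fin N) (Fin N) ℂ) :
    ((u ⊗ₖ v) ⊗ₖ (u ⊗ₖ v)) * swapFst N = swapFst N * ((u ⊗ₖ v) ⊗ₖ (u ⊗ₖ v)) := by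
  rw [mul_swapFst, swapFst_mul]
  ext p q
  simp only [exchangeFst, kroneckerMap_apply, submatrix_apply, Equiv.coe_fn_mk, id]
  ring

lemma kronecker_local_mul_swapSnd (u v : Matrix (Fin N) (Fin N) ℂ) :
    ((u ⊗ₖ v) ⊗ₖ (u ⊗ₖ v)) * swapSnd N = swapSnd N * ((u ⊗ₖ v) ⊗ₖ (u ⊗ₖ v)) := by
  rw [mul_swapSnd, swapSnd_mul]
  ext p q
  simp only [exchangeSnd, kroneckerMap_apply, submatrix_apply, Equiv.coe_fn_mk, id]
  ring

lemma Xpur_eq (U : Matrix (Fin N × Fin N) (Fin N × Fin N) ℂ) :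
    Xpur N U =
      ((N : ℝ) ^ 4)⁻¹ * (((U ⊗ₖ U) * swapFst N * (U ⊗ₖ U)ᴴ * swapFst N).trace).re := by
  have key : (reshuffle N U * (reshuffle N U)ᴴ * (reshuffle N U * (reshuffle N U)ᴴ)).trace =
      ((U ⊗ₖ U) * swapFst N * (U ⊗ₖ U)ᴴ * swapFst N).trace := by
    rw [mul_assoc _ _ (swapFst N), mul_swapFst, mul_swapFst]
    simp only [trace, diag_apply, mul_apply, Finset.sum_mul_sum]
    simp only [← Fintype.sum_prod_type']
    let e : (Fin N × Fin N) × (Fin N × Fin N) × (Fin N × Fin N) × (Fin N × Fin N) ≃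
        ((Fin N × Fin N) × (Fin N × Fin N)) × ((Fin N × Fin N) × (Fin N × Fin N)) :=
      { toFun := fun x => (((x.1.1, x.2.2.1.1), (x.2.1.1, x.2.2.2.1)),
          ((x.2.1.2, x.2.2.1.2), (x.1.2, x.2.2.2.2)))
        invFun := fun y => ((y.1.1.1, y.2.2.1), (y.1.2.1, y.2.1.1), (y.1.1.2, y.2.1.2),
          (y.1.2.2, y.2.2.2))
        left_inv := fun _ => rfl
        right_inv := fun _ => rfl }
    refine Fintype.sum_equiv (M := ℂ) e _ _ fun x => ?_
    simp only [reshuffle, exchangeFst, kroneckerMap_apply, conjTranspose_apply, of_apply,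
      submatrix_apply, Equiv.coe_fn_mk, id, star_mul', e]
    ring
  have hN : (((N : ℂ) ^ 2)⁻¹ * ((N : ℂ) ^ 2)⁻¹) = (((N : ℝ) ^ 4)⁻¹ : ℝ) := by
    push_cast
    rw [← mul_inv, ← pow_add]
  rw [Xpur, rhoR, Matrix.smul_mul, Matrix.mul_smul, smul_smul, trace_smul, key, hN, smul_eq_mul,
    Complex.re_ofReal_mul]

lemma swapGate_mul_self : swapGate N * swapGate N = 1 := by
  ext ⟨p, p'⟩ ⟨q, q'⟩
  simp [swapGate, mul_apply, one_apply, Fintype.sum_prod_type, ite_and, Prod.ext_iff]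

lemma Ypur_eq (U : Matrix (Fin N × Fin N) (Fin N × Fin N) ℂ) :
    Ypur N U =
      ((N : ℝ) ^ 4)⁻¹ * (((U ⊗ₖ U) * swapFst N * (U ⊗ₖ U)ᴴ * swapSnd N).trace).re := by
  have key : (ptransp N U * (ptransp N U)ᴴ * (ptransp N U * (ptransp N U)ᴴ)).trace =
      ((U ⊗ₖ U) * swapFst N * (U ⊗ₖ U)ᴴ * swapSnd N).trace := by
    rw [mul_assoc _ _ (swapSnd N), mul_swapFst, mul_swapSnd]
    simp only [trace, diag_apply, mul_apply, Finset.sum_mul_sum]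
    simp only [← Fintype.sum_prod_type']
    let e : (Fin N × Fin N) × (Fin N × Fin N) × (Fin N × Fin N) × (Fin N × Fin N) ≃
        ((Fin N × Fin N) × (Fin N × Fin N)) × ((Fin N × Fin N) × (Fin N × Fin N)) :=
      { toFun := fun x => (((x.2.2.1.1, x.1.2), (x.2.2.2.1, x.2.1.2)),
          ((x.2.1.1, x.2.2.1.2), (x.1.1, x.2.2.2.2)))
        invFun := fun y => ((y.2.2.1, y.1.1.2), (y.2.1.1, y.1.2.2), (y.1.1.1, y.2.1.2),
          (y.1.2.1, y.2.2.2))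
        left_inv := fun _ => rfl
        right_inv := fun _ => rfl }
    refine Fintype.sum_equiv (M := ℂ) e _ _ fun x => ?_
    simp only [ptransp, exchangeFst, exchangeSnd, kroneckerMap_apply, conjTranspose_apply,
      of_apply, submatrix_apply, Equiv.coe_fn_mk, id, star_mul', e]
    ring
  have hN : (((N : ℂ) ^ 2)⁻¹ * ((N : ℂ) ^ 2)⁻¹) = (((N : ℝ) ^ 4)⁻¹ : ℝ) := by
    push_cast
    rw [← mul_inv, ← pow_add]
  have hS : (swapGate N * (ptransp N U * (ptransp N U)ᴴ) * swapGate N *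
      (swapGate N * (ptransp N U * (ptransp N U)ᴴ) * swapGate N)).trace =
      (ptransp N U * (ptransp N U)ᴴ * (ptransp N U * (ptransp N U)ᴴ)).trace := by
    set A := ptransp N U * (ptransp N U)ᴴ
    calc _ = (swapGate N * (A * (swapGate N * swapGate N) * A * swapGate N)).trace := by
          simp only [mul_assoc]
      _ = (A * (swapGate N * swapGate N) * A * (swapGate N * swapGate N)).trace := by
          rw [trace_mul_comm]
          simp only [mul_assoc]
      _ = _ := by rw [swapGate_mul_self, mul_one, mul_one]
  rw [Ypur, rhoT, Matrix.smul_mul, Matrix.mul_smul, smul_smul, trace_smul, hS, key, hN,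
    smul_eq_mul, Complex.re_ofReal_mul]

end swap

lemma local_commutant {N : ℕ} (hN : 2 ≤ N)
    (P : Matrix ((Fin N × Fin N) × (Fin N × Fin N)) ((Fin N × Fin N) × (Fin N × Fin N)) ℂ)
    (hP : ∀ u ∈ unitaryGroup (Fin N) ℂ, ∀ v ∈ unitaryGroup (Fin N) ℂ,
      ((u ⊗ₖ v) ⊗ₖ (u ⊗ₖ v)) * P = P * ((u ⊗ₖ v) ⊗ₖ (u ⊗ₖ v))) :
    ∃ x y z w : ℂ, P = x • 1 + y • swapFst N + z • swapSnd N + w • (swapFst N * swapSnd N) := by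
  let e₀ : Fin N := ⟨0, by omega⟩
  let e₁ : Fin N := ⟨1, by omega⟩
  have he : e₀ ≠ e₁ := by simp [e₀, e₁]
  have h1 : ∀ b b' d d', _ := fun b b' d d' =>
    commutant_tensor_sq (fun a a' c c' => P ((a, b), (a', b')) ((c, d), (c', d')))
    (fun u hu a a' c c' => by
      have := congrFun (congrFun (hP u hu 1 (one_mem _)) ((a, b), (a', b'))) ((c, d), (c', d'))
      simp only [mul_apply, kroneckerMap_apply, Fintype.sum_prod_type, one_apply] at this
      simpa [ite_and] using this.symm) he
  have h2 : ∀ a a' c c', _ := fun a a' c c' =>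
    commutant_tensor_sq (fun b b' d d' => P ((a, b), (a', b')) ((c, d), (c', d')))
    (fun u hu b b' d d' => by
      have := congrFun (congrFun (hP 1 (one_mem _) u hu) ((a, b), (a', b'))) ((c, d), (c', d'))
      simp only [mul_apply, kroneckerMap_apply, Fintype.sum_prod_type, one_apply] at this
      simpa [ite_and] using this.symm) he
  refine ⟨P ((e₀, e₀), (e₁, e₁)) ((e₀, e₀), (e₁, e₁)), P ((e₀, e₀), (e₁, e₁)) ((e₁, e₀), (e₀, e₁)),
    P ((e₀, e₀), (e₁, e₁)) ((e₀, e₁), (e₁, e₀)), P ((e₀, e₀), (e₁, e₁)) ((e₁, e₁), (e₀, e₀)), ?_⟩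
  ext ⟨⟨a, b⟩, ⟨a', b'⟩⟩ ⟨⟨c, d⟩, ⟨c', d'⟩⟩
  have h3 := h1 b b' d d' a a' c c'
  rw [h2 e₀ e₁ e₀ e₁ b b' d d', h2 e₀ e₁ e₁ e₀ b b' d d'] at h3
  rw [h3, swapFst_mul]
  simp only [Matrix.add_apply, Matrix.smul_apply, swapFst_apply, swapSnd_apply, submatrix_apply,
    one_apply, exchangeFst, exchangeSnd, Equiv.coe_fn_mk, Prod.mk.injEq, id, smul_eq_mul]
  have hi : ∀ (p q : Prop) [Decidable p] [Decidable q],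
      (if p ∧ q then (1 : ℂ) else 0) = (if p then 1 else 0) * (if q then 1 else 0) := by
    intro p q _ _
    by_cases p <;> by_cases q <;> simp [*]
  simp only [hi]
  ring

section exchange

variable {J : Type*} [Fintype J] [DecidableEq J] {a b W W' : Matrix J J ℂ}

lemma symProj_add_antiProj :
    (1 + a) * (1 + b) + (1 - a) * (1 - b) = (2 : ℂ) • (1 + a * b) := by
  rw [two_smul]
  noncomm_ring

lemma trace_conj_symProj_mul_antiProj (ha : a * a = 1) (hb : b * b = 1) (hab : a * b = b * a)
    (hW : W * W' = 1) (hW' : W' * W = 1) (hc : W * (a * b) = a * b * W) :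
    (W * ((1 + a) * (1 + b)) * W' * ((1 - a) * (1 - b))).trace =
      2 * ((1 : Matrix J J ℂ).trace + (a * b).trace - (W * a * W' * a).trace -
        (W * a * W' * b).trace) := by
  have haba : a * b * a = b := by rw [hab, mul_assoc, ha, mul_one]
  have hp : (1 + a) * (1 + b) = (1 + a * b) * (1 + a) := by
    have : (1 + a * b) * (1 + a) = 1 + a + a * b * a + a * b := by noncomm_ring
    rw [this, haba]
    noncomm_ring
  have hm : (1 - a) * (1 - b) * (1 + a * b) = (2 : ℂ) • ((1 - a) * (1 - b)) := by
    have : (1 - a) * (1 - b) * (1 + a * b) =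
      1 - a - b + a * b + a * b - (a * a) * b - (b * a) * b + a * (b * a) * b := by noncomm_ring
    rw [this, ← hab, ha, one_mul, mul_assoc a b b, hb, mul_one, ← mul_assoc a a b, ha, one_mul, hb,
      two_smul]
    noncomm_ring
  have h1 : W * ((1 + a) * (1 + b)) * W' = (1 + a * b) * (1 + W * a * W') := by
    calc _ = (W * (1 + a * b)) * (1 + a) * W' := by rw [hp]; simp only [mul_assoc]
      _ = (1 + a * b) * (W * (1 + a) * W') := by
          have : W * (1 + a * b) = (1 + a * b) * W := by
            rw [mul_add, add_mul, hc, mul_one, one_mul]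
          rw [this]
          simp only [mul_assoc]
      _ = _ := by
          congr 1
          rw [mul_add W, add_mul, mul_one, hW]
  have h2 : (W * a * W').trace = a.trace := by
    rw [trace_mul_comm, ← mul_assoc, hW', one_mul]
  have h3 : (W * a * W' * (a * b)).trace = b.trace := by
    have : W' * (a * b) = a * b * W' := by
      calc W' * (a * b) = W' * (a * b * W) * W' := by
            rw [mul_assoc, mul_assoc, hW, mul_one]
        _ = W' * W * (a * b) * W' := by rw [← hc]; simp only [mul_assoc]
        _ = _ := by rw [hW', one_mul]
    rw [mul_assoc, this, trace_mul_comm]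
    calc (a * b * W' * (W * a)).trace = (a * b * (W' * W) * a).trace := by simp only [mul_assoc]
      _ = _ := by rw [hW', mul_one, haba]
  rw [h1, mul_assoc, trace_mul_comm, mul_assoc, hm]
  have : (1 + W * a * W') * ((2 : ℂ) • ((1 - a) * (1 - b))) =
      (2 : ℂ) • (1 - a - b + a * b + W * a * W' - W * a * W' * a - W * a * W' * b +
        W * a * W' * (a * b)) := by
    rw [Matrix.mul_smul]
    congr 1
    noncomm_ring
  rw [this]
  simp only [trace_smul, trace_add, trace_sub, h2, h3, smul_eq_mul]
  ring

end exchange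

/-- Four times the projection onto the doubly symmetric subspace of two copies. -/
def symProj (N : ℕ) :
    Matrix ((Fin N × Fin N) × (Fin N × Fin N)) ((Fin N × Fin N) × (Fin N × Fin N)) ℂ :=
  (1 + swapFst N) * (1 + swapSnd N)

/-- Four times the projection onto the doubly antisymmetric subspace of two copies. -/
def antiProj (N : ℕ) :
    Matrix ((Fin N × Fin N) × (Fin N × Fin N)) ((Fin N × Fin N) × (Fin N × Fin N)) ℂ :=
  (1 - swapFst N) * (1 - swapSnd N)

section proj

variable (N : ℕ)

lemma symProj_eq : symProj N = 1 + swapFst N + swapSnd N + swapFst N * swapSnd N := by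
  rw [symProj]
  noncomm_ring

lemma antiProj_eq : antiProj N = 1 - swapFst N - swapSnd N + swapFst N * swapSnd N := by
  rw [antiProj]
  noncomm_ring

lemma one_add_swap_sq : (1 + swapFst N) * (1 + swapFst N) = (2 : ℂ) • (1 + swapFst N) ∧
    (1 + swapSnd N) * (1 + swapSnd N) = (2 : ℂ) • (1 + swapSnd N) := by
  constructor <;> rw [mul_add, add_mul, add_mul, two_smul] <;>
    simp only [swapFst_mul_self, swapSnd_mul_self, mul_one, one_mul] <;> abel

lemma one_sub_swap_sq : (1 - swapFst N) * (1 - swapFst N) = (2 : ℂ) • (1 - swapFst N) ∧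
    (1 - swapSnd N) * (1 - swapSnd N) = (2 : ℂ) • (1 - swapSnd N) := by
  constructor <;> rw [mul_sub, sub_mul, sub_mul, two_smul] <;>
    simp only [swapFst_mul_self, swapSnd_mul_self, mul_one, one_mul] <;> abel

lemma commute_swap : Commute (swapFst N) (swapSnd N) := swapFst_mul_swapSnd_comm N

lemma symProj_mul_self : symProj N * symProj N = (4 : ℂ) • symProj N := by
  have h : Commute (1 + swapSnd N) (1 + swapFst N) :=
    ((Commute.one_left _).add_left
      ((Commute.one_right _).add_right (commute_swap N).symm))
  rw [symProj, mul_assoc, ← mul_assoc (1 + swapSnd N), h.eq, mul_assoc (1 + swapFst N), ← mul_assoc,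
    (one_add_swap_sq N).1, (one_add_swap_sq N).2, Matrix.mul_smul, Matrix.smul_mul, smul_smul]
  norm_num

lemma antiProj_mul_self : antiProj N * antiProj N = (4 : ℂ) • antiProj N := by
  have h : Commute (1 - swapSnd N) (1 - swapFst N) :=
    ((Commute.one_left _).sub_left
      ((Commute.one_right _).sub_right (commute_swap N).symm))
  rw [antiProj, mul_assoc, ← mul_assoc (1 - swapSnd N), h.eq, mul_assoc (1 - swapFst N),
    ← mul_assoc, (one_sub_swap_sq N).1, (one_sub_swap_sq N).2, Matrix.mul_smul, Matrix.smul_mul,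
    smul_smul]
  norm_num

lemma symProj_add_antiProj_eq :
    symProj N + antiProj N = (2 : ℂ) • (1 + swapFst N * swapSnd N) :=
  symProj_add_antiProj

lemma symProj_mul_antiProj : symProj N * antiProj N = 0 := by
  have h : Commute (1 + swapSnd N) (1 - swapFst N) :=
    ((Commute.one_left _).add_left
      ((Commute.one_right _).sub_right (commute_swap N).symm))
  have h0 : (1 + swapFst N) * (1 - swapFst N) = 0 := by
    rw [mul_sub, add_mul, add_mul, swapFst_mul_self]
    simp [add_comm]
  rw [symProj, antiProj, mul_assoc, ← mul_assoc (1 + swapSnd N), h.eq, mul_assoc (1 - swapFst N),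
    ← mul_assoc, h0, zero_mul]

lemma antiProj_mul_symProj : antiProj N * symProj N = 0 := by
  have h : Commute (1 - swapSnd N) (1 + swapFst N) :=
    ((Commute.one_left _).sub_left
      ((Commute.one_right _).add_right (commute_swap N).symm))
  have h0 : (1 - swapFst N) * (1 + swapFst N) = 0 := by
    rw [mul_add, sub_mul, sub_mul, swapFst_mul_self]
    simp [add_comm]
  rw [symProj, antiProj, mul_assoc, ← mul_assoc (1 - swapSnd N), h.eq, mul_assoc (1 + swapFst N),
    ← mul_assoc, h0, zero_mul]

lemma conjTranspose_symProj : (symProj N)ᴴ = symProj N := by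
  rw [symProj_eq]
  simp only [conjTranspose_add, conjTranspose_one, conjTranspose_mul, conjTranspose_swapFst,
    conjTranspose_swapSnd, swapFst_mul_swapSnd_comm]

lemma conjTranspose_antiProj : (antiProj N)ᴴ = antiProj N := by
  rw [antiProj_eq]
  simp only [conjTranspose_add, conjTranspose_sub, conjTranspose_one, conjTranspose_mul,
    conjTranspose_swapFst, conjTranspose_swapSnd, swapFst_mul_swapSnd_comm]

lemma trace_one_two_copies :
    (1 : Matrix ((Fin N × Fin N) × (Fin N × Fin N)) _ ℂ).trace = (N : ℂ) ^ 4 := by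
  rw [trace_one]
  simp only [Fintype.card_prod, Fintype.card_fin, Nat.cast_mul]
  ring

lemma trace_symProj : (symProj N).trace = (N : ℂ) ^ 2 * (N + 1) ^ 2 := by
  rw [symProj_eq]
  simp only [trace_add, trace_one_two_copies, trace_swapFst, trace_swapSnd,
    trace_swapFst_mul_swapSnd]
  ring

lemma trace_antiProj : (antiProj N).trace = (N : ℂ) ^ 2 * (N - 1) ^ 2 := by
  rw [antiProj_eq]
  simp only [trace_add, trace_sub, trace_one_two_copies, trace_swapFst, trace_swapSnd,
    trace_swapFst_mul_swapSnd]
  ring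

variable {N}

/-- The entangling power is the leakage of the two-copy gate from the doubly symmetric to the
doubly antisymmetric subspace. -/
lemma trace_symProj_antiProj_eq_ep (hN : 2 ≤ N)
    {U : Matrix (Fin N × Fin N) (Fin N × Fin N) ℂ} (hU : U ∈ unitaryGroup (Fin N × Fin N) ℂ) :
    ((U ⊗ₖ U) * symProj N * (U ⊗ₖ U)ᴴ * antiProj N).trace =
      ((2 * (N : ℝ) ^ 2 * (N + 1) ^ 2 * ep N U : ℝ) : ℂ) := by
  have hW : U ⊗ₖ U ∈ unitaryGroup _ ℂ := kronecker_mem_unitary hU hU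
  have hWW : (U ⊗ₖ U) * (U ⊗ₖ U)ᴴ = 1 := mem_unitaryGroup_iff.1 hW
  have hWW' : (U ⊗ₖ U)ᴴ * (U ⊗ₖ U) = 1 := mem_unitaryGroup_iff'.1 hW
  apply Complex.ext
  · rw [Complex.ofReal_re, symProj, antiProj, trace_conj_symProj_mul_antiProj (swapFst_mul_self N)
      (swapSnd_mul_self N) (swapFst_mul_swapSnd_comm N) hWW
      hWW' (kronecker_self_mul_swap U), ep, Xpur_eq, Ypur_eq,
      trace_one_two_copies, trace_swapFst_mul_swapSnd]
    have hN0 : (N : ℝ) ≠ 0 := by positivity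
    have hN1 : (N : ℝ) + 1 ≠ 0 := by positivity
    have e1 : (((N : ℂ) ^ 4).re) = (N : ℝ) ^ 4 := by exact_mod_cast Complex.ofReal_re ((N : ℝ) ^ 4)
    have e2 : (((N : ℂ) ^ 2).re) = (N : ℝ) ^ 2 := by exact_mod_cast Complex.ofReal_re ((N : ℝ) ^ 2)
    have e3 : ∀ z : ℂ, (2 * z).re = 2 * z.re := fun z => by simp
    rw [e3, Complex.sub_re, Complex.sub_re, Complex.add_re, e1, e2]
    field_simp
    ring
  · rw [Complex.ofReal_im, ← Complex.conj_eq_iff_im, ← Complex.star_def, ← trace_conjTranspose]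
    simp only [conjTranspose_mul, conjTranspose_conjTranspose, conjTranspose_symProj,
      conjTranspose_antiProj]
    rw [trace_mul_comm]
    simp only [mul_assoc]

end proj

section twirl

variable {N : ℕ}

lemma swap_mul_symProj : swapFst N * swapSnd N * symProj N = symProj N := by
  have h1 : swapFst N * (1 + swapFst N) = 1 + swapFst N := by
    rw [mul_add, swapFst_mul_self, mul_one, add_comm]
  have h2 : swapSnd N * (1 + swapSnd N) = 1 + swapSnd N := by
    rw [mul_add, swapSnd_mul_self, mul_one, add_comm]
  have h : Commute (swapSnd N) (1 + swapFst N) :=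
    (Commute.one_right _).add_right (commute_swap N).symm
  rw [symProj, mul_assoc, ← mul_assoc (swapSnd N), h.eq, mul_assoc (1 + swapFst N), ← mul_assoc, h1,
    h2]

/-- A two-copy operator fixed by the full exchange has a local-unitary average in the span of
`symProj` and `antiProj`. -/
lemma exists_local_twirl (hN : 2 ≤ N)
    (M : Matrix ((Fin N × Fin N) × (Fin N × Fin N)) ((Fin N × Fin N) × (Fin N × Fin N)) ℂ)
    (hM : swapFst N * swapSnd N * M = M) :
    ∃ x y : ℂ, 4 * x * (symProj N).trace = (M * symProj N).trace ∧
      4 * y * (antiProj N).trace = (M * antiProj N).trace ∧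
      ∀ (φ : Matrix ((Fin N × Fin N) × (Fin N × Fin N))
          ((Fin N × Fin N) × (Fin N × Fin N)) ℂ →ₗ[ℝ] ℝ) (c : ℝ),
        (∀ u ∈ unitaryGroup (Fin N) ℂ, ∀ v ∈ unitaryGroup (Fin N) ℂ,
          φ (((u ⊗ₖ v) ⊗ₖ (u ⊗ₖ v)) * M * ((u ⊗ₖ v) ⊗ₖ (u ⊗ₖ v))ᴴ) ≤ c) →
        φ (x • symProj N + y • antiProj N) ≤ c := by
  let L : unitaryGroup (Fin N) ℂ × unitaryGroup (Fin N) ℂ →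
      Matrix ((Fin N × Fin N) × (Fin N × Fin N)) ((Fin N × Fin N) × (Fin N × Fin N)) ℂ :=
    fun g => ((g.1 : Matrix (Fin N) (Fin N) ℂ) ⊗ₖ (g.2 : Matrix (Fin N) (Fin N) ℂ)) ⊗ₖ
      ((g.1 : Matrix (Fin N) (Fin N) ℂ) ⊗ₖ (g.2 : Matrix (Fin N) (Fin N) ℂ))
  have hL : ∀ g, L g ∈ unitaryGroup _ ℂ := fun g =>
    kronecker_mem_unitary (kronecker_mem_unitary g.1.2 g.2.2) (kronecker_mem_unitary g.1.2 g.2.2)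
  have hL' : ∀ g, (L g)ᴴ * L g = 1 := fun g => mem_unitaryGroup_iff'.1 (hL g)
  obtain ⟨P, hcomm, hP⟩ := exists_unitary_twirl L hL
    (fun g h => ⟨g * h, by simp only [L, ← mul_kronecker_mul]; rfl⟩) M
  have hR : ∀ φ : Matrix ((Fin N × Fin N) × (Fin N × Fin N))
      ((Fin N × Fin N) × (Fin N × Fin N)) ℂ →ₗ[ℝ] ℝ,
      (∀ g, φ (L g * M * (L g)ᴴ) = φ M) → φ P = φ M := by
    intro φ h
    refine le_antisymm (hP φ _ fun g => (h g).le) ?_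
    have := hP (-φ) (-φ M) fun g => by simp [h g]
    simpa using this
  have hC : ∀ ψ : Matrix ((Fin N × Fin N) × (Fin N × Fin N))
      ((Fin N × Fin N) × (Fin N × Fin N)) ℂ →ₗ[ℂ] ℂ,
      (∀ g, ψ (L g * M * (L g)ᴴ) = ψ M) → ψ P = ψ M := by
    intro ψ h
    apply Complex.ext
    · exact hR (Complex.reLm ∘ₗ ψ.restrictScalars ℝ) fun g => by simp [h g]
    · exact hR (Complex.imLm ∘ₗ ψ.restrictScalars ℝ) fun g => by simp [h g]
  have hF : ∀ g, Commute (L g) (swapFst N) := fun g => kronecker_local_mul_swapFst _ _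
  have hS : ∀ g, Commute (L g) (swapSnd N) := fun g => kronecker_local_mul_swapSnd _ _
  have htrace : ∀ D, (∀ g, Commute (L g) D) → (P * D).trace = (M * D).trace := by
    intro D hD
    refine hC (traceLinearMap _ ℂ ℂ ∘ₗ LinearMap.mulRight ℂ D) fun g => ?_
    simp only [LinearMap.comp_apply, LinearMap.mulRight_apply, traceLinearMap_apply]
    calc _ = (L g * (M * (L g)ᴴ * D)).trace := by simp only [mul_assoc]
      _ = (M * (L g)ᴴ * (D * L g)).trace := by rw [trace_mul_comm]; simp only [mul_assoc]
      _ = (M * ((L g)ᴴ * L g) * D).trace := by rw [← (hD g).eq]; simp only [mul_assoc]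
      _ = _ := by rw [hL', mul_one]
  have hCP : swapFst N * swapSnd N * P = P := by
    ext i j
    rw [← sub_eq_zero]
    have := hC ((entryLinearMap ℂ ℂ i j) ∘ₗ
      (LinearMap.mulLeft ℂ (swapFst N * swapSnd N) - LinearMap.id)) fun g => by
        have h : swapFst N * swapSnd N * (L g * M * (L g)ᴴ) = L g * M * (L g)ᴴ := by
          calc _ = (swapFst N * swapSnd N * L g) * M * (L g)ᴴ := by simp only [mul_assoc]
            _ = (L g * (swapFst N * swapSnd N)) * M * (L g)ᴴ := by
                rw [((hF g).mul_right (hS g)).eq]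
            _ = L g * (swapFst N * swapSnd N * M) * (L g)ᴴ := by simp only [mul_assoc]
            _ = _ := by rw [hM]
        simp only [LinearMap.comp_apply, LinearMap.sub_apply, LinearMap.mulLeft_apply,
          LinearMap.id_apply, h, hM, sub_self]
    simpa only [LinearMap.comp_apply, LinearMap.sub_apply, LinearMap.mulLeft_apply,
      LinearMap.id_apply, hM, sub_self, map_zero, entryLinearMap_apply, Matrix.sub_apply]
      using this
  obtain ⟨p, q, r, s, hpqrs⟩ := local_commutant hN P fun u hu v hv =>
    hcomm (⟨u, hu⟩, ⟨v, hv⟩)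
  have hform : P = ((p + q + r + s) / 4) • symProj N + ((p + s - q - r) / 4) • antiProj N := by
    have h1 : swapFst N * swapSnd N * swapFst N = swapSnd N := by
      rw [swapFst_mul_swapSnd_comm, mul_assoc, swapFst_mul_self, mul_one]
    have h2 : swapFst N * swapSnd N * swapSnd N = swapFst N := by
      rw [mul_assoc, swapSnd_mul_self, mul_one]
    have h3 : swapFst N * swapSnd N * (swapFst N * swapSnd N) = 1 := by
      rw [← mul_assoc, h1, swapSnd_mul_self]
    have h4 : P = p • (swapFst N * swapSnd N) + q • swapSnd N + r • swapFst N + s • 1 := by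
      rw [← hCP, hpqrs]
      simp only [mul_add, Matrix.mul_smul, h1, h2, h3, mul_one]
    have h5 : P = (1 / 2 : ℂ) • (P + P) := by rw [← two_smul ℂ, smul_smul]; norm_num
    rw [h5]
    nth_rewrite 1 [hpqrs]
    rw [h4, symProj_eq, antiProj_eq]
    module
  have hsym : ∀ g, Commute (L g) (symProj N) := fun g =>
    ((Commute.one_right _).add_right (hF g)).mul_right ((Commute.one_right _).add_right (hS g))
  have hanti : ∀ g, Commute (L g) (antiProj N) := fun g =>
    ((Commute.one_right _).sub_right (hF g)).mul_right ((Commute.one_right _).sub_right (hS g))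
  have hPs := htrace _ hsym
  have hPa := htrace _ hanti
  rw [hform, add_mul, Matrix.smul_mul, Matrix.smul_mul, symProj_mul_self, antiProj_mul_symProj,
    smul_zero, add_zero, trace_smul, trace_smul, smul_eq_mul, smul_eq_mul] at hPs
  rw [hform, add_mul, Matrix.smul_mul, Matrix.smul_mul, antiProj_mul_self, symProj_mul_antiProj,
    smul_zero, zero_add, trace_smul, trace_smul, smul_eq_mul, smul_eq_mul] at hPa
  refine ⟨(p + q + r + s) / 4, (p + s - q - r) / 4, by rw [← hPs]; ring, by rw [← hPa]; ring,
    fun φ c h => ?_⟩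
  rw [← hform]
  exact hP φ c fun g => h _ g.1.2 _ g.2.2

/-- The average of `e_p(V (u ⊗ v) V)` over local unitaries is `e_p(V) (2 - e_p(V) / ē_p)`, hence any
upper bound of these entangling powers is at least that. -/
lemma exists_local_ep_ge (hN : 2 ≤ N) {V : Matrix (Fin N × Fin N) (Fin N × Fin N) ℂ}
    (hV : V ∈ unitaryGroup (Fin N × Fin N) ℂ) {c : ℝ}
    (hc : ∀ u ∈ unitaryGroup (Fin N) ℂ, ∀ v ∈ unitaryGroup (Fin N) ℂ,
      ep N (V * (u ⊗ₖ v) * V) ≤ c) :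
    ep N V * (2 - ep N V / epBar N) ≤ c := by
  set W := V ⊗ₖ V with hWdef
  have hWu : W ∈ unitaryGroup _ ℂ := kronecker_mem_unitary hV hV
  have hW : W * Wᴴ = 1 := mem_unitaryGroup_iff.1 hWu
  have hW' : Wᴴ * W = 1 := mem_unitaryGroup_iff'.1 hWu
  have hsw := kronecker_self_mul_swap V
  rw [← hWdef] at hsw
  have ht := trace_symProj_antiProj_eq_ep hN hV
  rw [← hWdef] at ht
  have hconj : ∀ D, (W * D * Wᴴ).trace = D.trace := fun D => by
    rw [trace_mul_comm, ← mul_assoc, hW', one_mul]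
  have hsum : W * (symProj N + antiProj N) * Wᴴ = symProj N + antiProj N := by
    rw [symProj_add_antiProj_eq, Matrix.mul_smul, Matrix.smul_mul, mul_add, hsw, mul_one,
      ← one_add_mul, mul_assoc, hW, mul_one]
  obtain ⟨x, y, hx, hy, hφ⟩ := exists_local_twirl hN (W * symProj N * Wᴴ) (by
    rw [← mul_assoc, ← mul_assoc, ← hsw, mul_assoc W, swap_mul_symProj])
  rw [ht] at hy
  have hx' : (W * symProj N * Wᴴ * symProj N).trace = 4 * (symProj N).trace -
      ((2 * (N : ℝ) ^ 2 * (N + 1) ^ 2 * ep N V : ℝ) : ℂ) := by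
    rw [← ht, eq_sub_iff_add_eq, ← trace_add, ← mul_add, mul_assoc, mul_assoc, ← hsum]
    calc _ = (W * symProj N * (Wᴴ * W) * (symProj N + antiProj N) * Wᴴ).trace := by
          simp only [mul_assoc]
      _ = _ := by
          rw [hW', mul_one, mul_assoc W, hconj, mul_add, symProj_mul_self, symProj_mul_antiProj,
            add_zero, trace_smul, smul_eq_mul]
  have hy' : (W * antiProj N * Wᴴ * antiProj N).trace = 4 * (antiProj N).trace -
      ((2 * (N : ℝ) ^ 2 * (N + 1) ^ 2 * ep N V : ℝ) : ℂ) := by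
    rw [← ht, eq_sub_iff_add_eq, ← trace_add, ← add_mul, ← add_mul, ← mul_add, add_comm, hsum,
      add_mul, antiProj_mul_self, symProj_mul_antiProj, zero_add, trace_smul, smul_eq_mul]
  have key := hφ (Complex.reLm ∘ₗ (traceLinearMap _ ℂ ℂ ∘ₗ LinearMap.mulRight ℂ (antiProj N) ∘ₗ
      LinearMap.mulRight ℂ Wᴴ ∘ₗ LinearMap.mulLeft ℂ W).restrictScalars ℝ)
    (2 * (N : ℝ) ^ 2 * (N + 1) ^ 2 * c) (fun u hu v hv => by
      have h1 := trace_symProj_antiProj_eq_ep hN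
        (mul_mem (mul_mem hV (kronecker_mem_unitary hu hv)) hV)
      rw [mul_kronecker_mul, mul_kronecker_mul, ← hWdef, conjTranspose_mul, conjTranspose_mul] at h1
      have h2 := congrArg Complex.re h1
      rw [Complex.ofReal_re] at h2
      simp only [LinearMap.comp_apply, LinearMap.restrictScalars_apply, LinearMap.mulRight_apply,
        LinearMap.mulLeft_apply, traceLinearMap_apply, Complex.reLm_coe]
      simp only [mul_assoc] at h2 ⊢
      rw [h2]
      gcongr
      simpa only [mul_assoc] using hc u hu v hv)
  simp only [LinearMap.comp_apply, LinearMap.restrictScalars_apply, LinearMap.mulRight_apply,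
    LinearMap.mulLeft_apply, traceLinearMap_apply, Complex.reLm_coe, mul_add, add_mul,
    Matrix.mul_smul, Matrix.smul_mul, trace_add, trace_smul, smul_eq_mul] at key
  rw [hx', trace_symProj] at hx
  rw [trace_antiProj] at hy
  rw [ht, hy', trace_antiProj] at key
  have hN2 : (2 : ℝ) ≤ N := by exact_mod_cast hN
  have hN0 : (N : ℝ) ≠ 0 := by linarith
  have hN1 : (N : ℝ) + 1 ≠ 0 := by linarith
  have hN3 : (N : ℝ) - 1 ≠ 0 := by linarith
  set e := ep N V
  have hxr : x = ((1 - e / 2 : ℝ) : ℂ) := by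
    have h0 : (N : ℂ) ≠ 0 := by exact_mod_cast hN0
    have h1 : (N : ℂ) + 1 ≠ 0 := by exact_mod_cast hN1
    have h2 : (4 * ((N : ℂ) ^ 2 * (N + 1) ^ 2)) ≠ 0 := by simp [h0, h1]
    apply mul_left_cancel₀ h2
    push_cast at hx ⊢
    linear_combination hx
  have hyr : y = ((((N : ℝ) + 1) ^ 2 / (N - 1) ^ 2 * (e / 2) : ℝ) : ℂ) := by
    have h0 : (N : ℂ) ≠ 0 := by exact_mod_cast hN0
    have h1 : (N : ℂ) - 1 ≠ 0 := by exact_mod_cast hN3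
    push_cast at hy ⊢
    field_simp
    apply mul_left_cancel₀ (pow_ne_zero 2 h0)
    linear_combination hy / 2
  have hreal : (x * ((2 * (N : ℝ) ^ 2 * (N + 1) ^ 2 * e : ℝ) : ℂ) +
      y * (4 * ((N : ℂ) ^ 2 * (N - 1) ^ 2) - ((2 * (N : ℝ) ^ 2 * (N + 1) ^ 2 * e : ℝ) : ℂ))) =
      ((2 * (N : ℝ) ^ 2 * (N + 1) ^ 2 * (e * (2 - e / epBar N)) : ℝ) : ℂ) := by
    have h0 : (N : ℂ) ≠ 0 := by exact_mod_cast hN0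
    have h1 : (N : ℂ) - 1 ≠ 0 := by exact_mod_cast hN3
    have h2 : (N : ℂ) ^ 2 + 1 ≠ 0 := by
      have : (N : ℝ) ^ 2 + 1 ≠ 0 := by positivity
      exact_mod_cast this
    rw [hxr, hyr, epBar]
    push_cast
    field_simp
    ring
  rw [hreal, Complex.ofReal_re] at key
  exact le_of_mul_le_mul_left key (by positivity)

end twirl

/-- If `e_p(V²) < e_p(V)(2 - e_p(V)/ē_p)` for a unitary `V` on
`ℂ^N ⊗ ℂ^N`, then there exist local unitaries `U^A, U^B` on `ℂ^N` with
`e_p(V²) < e_p(V (U^A ⊗ U^B) V)`. -/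
theorem exists_local_increasing_entangling_power (N : ℕ) (hN : 2 ≤ N)
    (V : Matrix (Fin N × Fin N) (Fin N × Fin N) ℂ)
    (hV : V ∈ Matrix.unitaryGroup (Fin N × Fin N) ℂ)
    (h : ep N (V ^ 2) < ep N V * (2 - ep N V / epBar N)) :
    ∃ UA UB : Matrix (Fin N) (Fin N) ℂ,
      UA ∈ Matrix.unitaryGroup (Fin N) ℂ ∧ UB ∈ Matrix.unitaryGroup (Fin N) ℂ ∧
        ep N (V ^ 2) < ep N (V * (UA ⊗ₖ UB) * V) := by
  by_contra! hcon
  exact (exists_local_ep_ge hN hV fun u hu v hv => hcon u v hu hv).not_gt h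
end
end

section
/- Let N ≥ 2 and let dU denote the Haar probability measure on the unitary group U(N). For any indices i₁, i₂, i'₁, i'₂, j₁, j₂, j'₁, j'₂ ∈ {1,…,N}: ∫_{U(N)} U_{i₁j₁} U_{i₂j₂} conj(U_{i'₁j'₁}) conj(U_{i'₂j'₂}) dU = (N²−1)^{−1}·(δ_{i₁i'₁}δ_{i₂i'₂}δ_{j₁j'₁}δ_{j₂j'₂} + δ_{i₁i'₂}δ_{i₂i'₁}δ_{j₁j'₂}δ_{j₂j'₁}) − (N(N²−1))^{−1}·(δ_{i₁i'₁}δ_{i₂i'₂}δ_{j₁j'₂}δ_{j₂j'₁} + δ_{i₁i'₂}δ_{i₂i'₁}δ_{j₁j'₁}δ_{j₂j'₂}). -/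
open Matrix MeasureTheory
open scoped Kronecker

noncomputable section

/-- Kronecker delta with values in `ℂ`. -/
def kdelta {N : ℕ} (a b : Fin N) : ℂ := if a = b then 1 else 0

/-- A tensor with two covariant and two contravariant indices is invariant under all unitaries. -/
def IsUnitaryInvariant {ι : Type*} [Fintype ι] [DecidableEq ι] (G : ι → ι → ι → ι → ℂ) : Prop :=
  ∀ V ∈ Matrix.unitaryGroup ι ℂ, ∀ a b c d, G a b c d =
    ∑ p, ∑ q, ∑ r, ∑ s,
      V a p * V b q * (starRingEnd ℂ) (V c r) * (starRingEnd ℂ) (V d s) * G p q r s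

namespace IsUnitaryInvariant

variable {ι : Type*} [Fintype ι] [DecidableEq ι] {G : ι → ι → ι → ι → ℂ}

theorem apply_perm (hG : IsUnitaryInvariant G) (σ : Equiv.Perm ι) (a b c d : ι) :
    G (σ a) (σ b) (σ c) (σ d) = G a b c d := by
  have hV : (Matrix.of fun i j => if σ i = j then (1 : ℂ) else 0) ∈ Matrix.unitaryGroup ι ℂ := by
    rw [Matrix.mem_unitaryGroup_iff]
    ext i j
    simp [Matrix.mul_apply, Matrix.star_apply, Matrix.one_apply, eq_comm, apply_ite]
  rw [hG _ hV a b c d]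
  simp [apply_ite (starRingEnd ℂ)]

theorem apply_diagonal (hG : IsUnitaryInvariant G) (k a b c d : ι) :
    G a b c d = (if a = k then Complex.I else 1) * (if b = k then Complex.I else 1) *
      (if c = k then -Complex.I else 1) * (if d = k then -Complex.I else 1) * G a b c d := by
  have hV : Matrix.diagonal (fun i => if i = k then Complex.I else 1) ∈
      Matrix.unitaryGroup ι ℂ := by
    rw [Matrix.mem_unitaryGroup_iff, Matrix.star_eq_conjTranspose, Matrix.diagonal_conjTranspose,
      Matrix.diagonal_mul_diagonal, ← Matrix.diagonal_one]
    congr 1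
    ext i
    by_cases h : i = k <;> simp [h]
  refine (hG _ hV a b c d).trans ?_
  simp [Matrix.diagonal_apply, apply_ite (starRingEnd ℂ), ite_mul, mul_ite]

theorem apply_eq_zero (hG : IsUnitaryInvariant G) {a b c d : ι}
    (h : ¬ (a = c ∧ b = d)) (h' : ¬ (a = d ∧ b = c)) : G a b c d = 0 := by
  have ha := hG.apply_diagonal a a b c d
  have hb := hG.apply_diagonal b a b c d
  by_contra h0
  have cancel : ∀ z : ℂ, G a b c d = z * G a b c d → z = 1 := fun z hz =>
    mul_right_cancel₀ h0 (by rw [one_mul]; exact hz.symm)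
  replace ha := cancel _ ha
  replace hb := cancel _ hb
  split_ifs at ha hb <;> simp [Complex.ext_iff] at ha hb <;> grind

theorem apply_reflection (hG : IsUnitaryInvariant G) {k l : ι} (hkl : k ≠ l) :
    G k k k k = G k l k l + G k l l k := by
  let w : ι → ℂ := Pi.single k 1 - Pi.single l 2
  have hw : w ⬝ᵥ w = 5 := by
    simp [w, hkl, hkl.symm]
    norm_num
  have hs : star w = w := by
    ext i
    simp [w, Pi.single_apply, apply_ite (starRingEnd ℂ), Complex.conj_ofNat]
  have hV : (1 - (2 / 5 : ℂ) • Matrix.vecMulVec w w) ∈ Matrix.unitaryGroup ι ℂ := by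
    have hsa : star (1 - (2 / 5 : ℂ) • Matrix.vecMulVec w w) =
        1 - (2 / 5 : ℂ) • Matrix.vecMulVec w w := by
      simp [Matrix.star_eq_conjTranspose, Matrix.conjTranspose_vecMulVec, hs]
    rw [Matrix.mem_unitaryGroup_iff, hsa, sub_mul, mul_sub, mul_sub, smul_mul_smul_comm,
      Matrix.vecMulVec_mul_vecMulVec, hw]
    ext i j
    simp [Matrix.vecMulVec_apply]
    ring
  have hrow : ∀ p, (1 - (2 / 5 : ℂ) • Matrix.vecMulVec w w) k p =
      (if p = k then 3 / 5 else 0) + (if p = l then 4 / 5 else 0) := by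
    intro p
    by_cases h : p = k
    · subst h
      simp [w, hkl, Matrix.vecMulVec_apply]
      norm_num
    · by_cases h' : p = l
      · subst h'
        simp [w, hkl, h, Matrix.vecMulVec_apply]
        norm_num
      · simp [w, hkl, h, h', Matrix.vecMulVec_apply, Ne.symm h]
  have key := hG _ hV k k k k
  simp only [hrow, map_add, apply_ite (starRingEnd ℂ), map_zero, add_mul, mul_add,
    Finset.sum_add_distrib, ite_mul, mul_ite, zero_mul, mul_zero, Finset.sum_ite_eq',
    Finset.mem_univ, if_true, map_div₀, map_ofNat] at key
  have hsw : ∀ a b c d, G (Equiv.swap k l a) (Equiv.swap k l b) (Equiv.swap k l c)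
    (Equiv.swap k l d) = G a b c d := hG.apply_perm _
  have h1 := hsw k k k k
  have h2 := hsw k l k l
  have h3 := hsw k l l k
  simp only [Equiv.swap_apply_left, Equiv.swap_apply_right] at h1 h2 h3
  have hlk := hkl.symm
  have z : ∀ a b c d, ¬ (a = c ∧ b = d) → ¬ (a = d ∧ b = c) → G a b c d = 0 :=
    fun _ _ _ _ => hG.apply_eq_zero
  rw [z k k k l, z k k l k, z k k l l, z k l k k, z k l l l, z l k k k, z l k l l, z l l k k,
    z l l k l, z l l l k, h1, h2, h3] at key <;> try simp [hkl, hlk]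
  linear_combination (625 / 288 : ℂ) * key

theorem eq_linear_combination (hG : IsUnitaryInvariant G) {x y : ι} (hxy : x ≠ y) (a b c d : ι) :
    G a b c d = G x y x y * ((if a = c then 1 else 0) * (if b = d then 1 else 0)) +
      G x y y x * ((if a = d then 1 else 0) * (if b = c then 1 else 0)) := by
  have hoff : ∀ k l, k ≠ l → G k l k l = G x y x y ∧ G k l l k = G x y y x := by
    intro k l hkl
    obtain ⟨σ, hx, hy⟩ : ∃ σ : Equiv.Perm ι, σ x = k ∧ σ y = l := by
      refine ⟨Equiv.swap (Equiv.swap x k y) l * Equiv.swap x k, ?_, by simp⟩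
      have hm : k ≠ Equiv.swap x k y := fun h =>
        hxy ((Equiv.swap x k).injective ((Equiv.swap_apply_left x k).trans h))
      simp [Equiv.swap_apply_of_ne_of_ne hm hkl]
    subst hx hy
    exact ⟨hG.apply_perm σ _ _ _ _, hG.apply_perm σ _ _ _ _⟩
  by_cases h : a = c ∧ b = d
  · obtain ⟨rfl, rfl⟩ := h
    by_cases hab : a = b
    · subst hab
      obtain ⟨l, hl⟩ : ∃ l, a ≠ l := by
        by_cases hax : a = x
        · exact ⟨y, hax ▸ hxy⟩
        · exact ⟨x, hax⟩
      simp [hG.apply_reflection hl, hoff a l hl]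
    · simp [hab, hoff a b hab]
  · by_cases h' : a = d ∧ b = c
    · obtain ⟨rfl, rfl⟩ := h'
      have hab : a ≠ b := fun hab => h ⟨hab, hab.symm⟩
      simp [hab, hoff a b hab]
    · simp [hG.apply_eq_zero h h', ← ite_and, h, h', and_comm]

end IsUnitaryInvariant

section HaarMoments

variable {ι : Type*} [Fintype ι] [DecidableEq ι]

theorem integrable_unitaryGroup_entries (μ : Measure (Matrix.unitaryGroup ι ℂ))
    [IsFiniteMeasure μ] (a b c d j₁ j₂ j₃ j₄ : ι) :
    Integrable (fun u : Matrix.unitaryGroup ι ℂ =>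
      (u : Matrix ι ι ℂ) a j₁ * (u : Matrix ι ι ℂ) b j₂ *
        (starRingEnd ℂ) ((u : Matrix ι ι ℂ) c j₃) *
        (starRingEnd ℂ) ((u : Matrix ι ι ℂ) d j₄)) μ := by
  have hc : ∀ i j, Continuous fun u : Matrix.unitaryGroup ι ℂ => (u : Matrix ι ι ℂ) i j :=
    fun i j => continuous_subtype_val.matrix_elem i j
  refine Integrable.of_bound (C := 1) (Continuous.aestronglyMeasurable ?_) (.of_forall fun u => ?_)
  · exact (((hc _ _).mul (hc _ _)).mul (Complex.continuous_conj.comp (hc _ _))).mul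
      (Complex.continuous_conj.comp (hc _ _))
  · have hb := entry_norm_bound_of_unitary u.2
    simp only [norm_mul, RCLike.norm_conj]
    exact mul_le_one₀ (mul_le_one₀ (mul_le_one₀ (hb _ _) (norm_nonneg _) (hb _ _))
      (norm_nonneg _) (hb _ _)) (norm_nonneg _) (hb _ _)

theorem isUnitaryInvariant_integral (μ : Measure (Matrix.unitaryGroup ι ℂ))
    [μ.IsMulLeftInvariant] [IsFiniteMeasure μ] (j₁ j₂ j₃ j₄ : ι) :
    IsUnitaryInvariant fun a b c d => ∫ u : Matrix.unitaryGroup ι ℂ,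
      (u : Matrix ι ι ℂ) a j₁ * (u : Matrix ι ι ℂ) b j₂ *
        (starRingEnd ℂ) ((u : Matrix ι ι ℂ) c j₃) *
        (starRingEnd ℂ) ((u : Matrix ι ι ℂ) d j₄) ∂μ := by
  intro V hV a b c d
  have hfi := fun p q r s => (integrable_unitaryGroup_entries μ p q r s j₁ j₂ j₃ j₄).const_mul
    (V a p * V b q * (starRingEnd ℂ) (V c r) * (starRingEnd ℂ) (V d s))
  have hexp : ∀ u : Matrix.unitaryGroup ι ℂ,
      (V * u) a j₁ * (V * u) b j₂ * (starRingEnd ℂ) ((V * u) c j₃) *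
        (starRingEnd ℂ) ((V * u) d j₄) =
      ∑ p, ∑ q, ∑ r, ∑ s, V a p * V b q * (starRingEnd ℂ) (V c r) * (starRingEnd ℂ) (V d s) *
        ((u : Matrix ι ι ℂ) p j₁ * (u : Matrix ι ι ℂ) q j₂ *
          (starRingEnd ℂ) ((u : Matrix ι ι ℂ) r j₃) *
          (starRingEnd ℂ) ((u : Matrix ι ι ℂ) s j₄)) := by
    intro u
    simp only [Matrix.mul_apply, map_sum, map_mul]
    rw [Finset.sum_mul_sum, Finset.sum_mul, Finset.sum_mul]
    refine Finset.sum_congr rfl fun p _ => ?_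
    rw [Finset.sum_mul, Finset.sum_mul]
    refine Finset.sum_congr rfl fun q _ => ?_
    rw [mul_assoc _ (∑ r, _), Finset.sum_mul_sum, Finset.mul_sum]
    simp only [Finset.mul_sum]
    exact Finset.sum_congr rfl fun r _ => Finset.sum_congr rfl fun s _ => by ring
  simp only [← integral_const_mul]
  rw [← integral_mul_left_eq_self _ (⟨V, hV⟩ : Matrix.unitaryGroup ι ℂ)]
  refine (integral_congr_ae (.of_forall hexp)).trans ?_
  rw [integral_finsetSum _ fun p _ => integrable_finsetSum _ fun q _ =>
    integrable_finsetSum _ fun r _ => integrable_finsetSum _ fun s _ => hfi p q r s]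
  refine Finset.sum_congr rfl fun p _ => ?_
  rw [integral_finsetSum _ fun q _ => integrable_finsetSum _ fun r _ =>
    integrable_finsetSum _ fun s _ => hfi p q r s]
  refine Finset.sum_congr rfl fun q _ => ?_
  rw [integral_finsetSum _ fun r _ => integrable_finsetSum _ fun s _ => hfi p q r s]
  refine Finset.sum_congr rfl fun r _ => ?_
  rw [integral_finsetSum _ fun s _ => hfi p q r s]

theorem sum_mul_conj_of_mem_unitaryGroup {U : Matrix ι ι ℂ} (hU : U ∈ Matrix.unitaryGroup ι ℂ)
    (j k : ι) : ∑ i, U i j * (starRingEnd ℂ) (U i k) = if j = k then 1 else 0 := by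
  have h := congrFun (congrFun (Matrix.mem_unitaryGroup_iff'.1 hU) k) j
  simpa [Matrix.mul_apply, Matrix.star_apply, Matrix.one_apply, mul_comm, eq_comm] using h

end HaarMoments

/-- The second-moment (Weingarten) formula for the Haar probability
measure on `U(N)`:
`∫ U_{i₁j₁} U_{i₂j₂} conj(U_{i'₁j'₁}) conj(U_{i'₂j'₂}) dU`
`= (N²−1)⁻¹ (δ_{i₁i'₁}δ_{i₂i'₂}δ_{j₁j'₁}δ_{j₂j'₂} + δ_{i₁i'₂}δ_{i₂i'₁}δ_{j₁j'₂}δ_{j₂j'₁})`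
`− (N(N²−1))⁻¹ (δ_{i₁i'₁}δ_{i₂i'₂}δ_{j₁j'₂}δ_{j₂j'₁} + δ_{i₁i'₂}δ_{i₂i'₁}δ_{j₁j'₁}δ_{j₂j'₂})`. -/
theorem haar_second_moment (N : ℕ) (hN : 2 ≤ N)
    (μ : Measure (Matrix.unitaryGroup (Fin N) ℂ)) [μ.IsHaarMeasure] [IsProbabilityMeasure μ]
    (i₁ i₂ i₁' i₂' j₁ j₂ j₁' j₂' : Fin N) :
    (∫ u : Matrix.unitaryGroup (Fin N) ℂ,
        (u : Matrix (Fin N) (Fin N) ℂ) i₁ j₁ * (u : Matrix (Fin N) (Fin N) ℂ) i₂ j₂ *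
          (starRingEnd ℂ) ((u : Matrix (Fin N) (Fin N) ℂ) i₁' j₁') *
          (starRingEnd ℂ) ((u : Matrix (Fin N) (Fin N) ℂ) i₂' j₂') ∂μ)
      = ((N : ℂ) ^ 2 - 1)⁻¹ *
          (kdelta i₁ i₁' * kdelta i₂ i₂' * kdelta j₁ j₁' * kdelta j₂ j₂'
            + kdelta i₁ i₂' * kdelta i₂ i₁' * kdelta j₁ j₂' * kdelta j₂ j₁')
        - ((N : ℂ) * ((N : ℂ) ^ 2 - 1))⁻¹ *
          (kdelta i₁ i₁' * kdelta i₂ i₂' * kdelta j₁ j₂' * kdelta j₂ j₁'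
            + kdelta i₁ i₂' * kdelta i₂ i₁' * kdelta j₁ j₁' * kdelta j₂ j₂') := by
  set F : Fin N → Fin N → Fin N → Fin N → ℂ := fun a b c d =>
    ∫ u : Matrix.unitaryGroup (Fin N) ℂ,
      (u : Matrix (Fin N) (Fin N) ℂ) a j₁ * (u : Matrix (Fin N) (Fin N) ℂ) b j₂ *
        (starRingEnd ℂ) ((u : Matrix (Fin N) (Fin N) ℂ) c j₁') *
        (starRingEnd ℂ) ((u : Matrix (Fin N) (Fin N) ℂ) d j₂') ∂μ with hF
  have hinv : IsUnitaryInvariant F := isUnitaryInvariant_integral μ j₁ j₂ j₁' j₂'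
  have hfi := integrable_unitaryGroup_entries μ
  have hxy : (⟨0, by omega⟩ : Fin N) ≠ ⟨1, by omega⟩ := by simp
  obtain ⟨A, B, hAB⟩ : ∃ A B : ℂ, ∀ a b c d,
      F a b c d = A * (kdelta a c * kdelta b d) + B * (kdelta a d * kdelta b c) :=
    ⟨_, _, hinv.eq_linear_combination hxy⟩
  have hdir : ∑ a, ∑ b, F a b a b = kdelta j₁ j₁' * kdelta j₂ j₂' := by
    simp_rw [hF, ← integral_finsetSum Finset.univ fun b _ => hfi _ b _ b j₁ j₂ j₁' j₂']
    rw [← integral_finsetSum _ fun a _ => integrable_finsetSum _ fun b _ => hfi _ _ _ _ _ _ _ _]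
    refine (integral_congr_ae (.of_forall fun u => ?_)).trans
      (integral_const (μ := μ) (kdelta j₁ j₁' * kdelta j₂ j₂') |>.trans (by simp))
    simp only [kdelta, ← sum_mul_conj_of_mem_unitaryGroup u.2, Finset.sum_mul_sum]
    exact Finset.sum_congr rfl fun a _ => Finset.sum_congr rfl fun b _ => by ring
  have hcross : ∑ a, ∑ b, F a b b a = kdelta j₁ j₂' * kdelta j₂ j₁' := by
    simp_rw [hF, ← integral_finsetSum Finset.univ fun b _ => hfi _ b b _ j₁ j₂ j₁' j₂']
    rw [← integral_finsetSum _ fun a _ => integrable_finsetSum _ fun b _ => hfi _ _ _ _ _ _ _ _]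
    refine (integral_congr_ae (.of_forall fun u => ?_)).trans
      (integral_const (μ := μ) (kdelta j₁ j₂' * kdelta j₂ j₁') |>.trans (by simp))
    simp only [kdelta, ← sum_mul_conj_of_mem_unitaryGroup u.2, Finset.sum_mul_sum]
    exact Finset.sum_congr rfl fun a _ => Finset.sum_congr rfl fun b _ => by ring
  simp only [hAB] at hdir hcross
  have hdir' : A * (N : ℂ) ^ 2 + B * N = kdelta j₁ j₁' * kdelta j₂ j₂' := by
    rw [← hdir]
    simp [kdelta, Finset.sum_add_distrib]
    ring
  have hcross' : A * N + B * (N : ℂ) ^ 2 = kdelta j₁ j₂' * kdelta j₂ j₁' := by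
    rw [← hcross]
    simp [kdelta, Finset.sum_add_distrib]
    ring
  have hN0 : (N : ℂ) ≠ 0 := by
    exact_mod_cast (by omega : N ≠ 0)
  have hN1 : (N : ℂ) ^ 2 - 1 ≠ 0 := by
    rw [sub_ne_zero]
    exact_mod_cast (by nlinarith : N ^ 2 ≠ 1)
  have hA : A = ((N : ℂ) ^ 2 - 1)⁻¹ * (kdelta j₁ j₁' * kdelta j₂ j₂') -
      ((N : ℂ) * ((N : ℂ) ^ 2 - 1))⁻¹ * (kdelta j₁ j₂' * kdelta j₂ j₁') := by
    rw [← hdir', ← hcross']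
    field_simp
    ring
  have hB : B = ((N : ℂ) ^ 2 - 1)⁻¹ * (kdelta j₁ j₂' * kdelta j₂ j₁') -
      ((N : ℂ) * ((N : ℂ) ^ 2 - 1))⁻¹ * (kdelta j₁ j₁' * kdelta j₂ j₂') := by
    rw [← hdir', ← hcross']
    field_simp
    ring
  refine (hAB i₁ i₂ i₁' i₂').trans ?_
  rw [hA, hB]
  ring
end
end

section
/- Let N ≥ 2 and let U be a unitary on ℂ^N ⊗ ℂ^N. The average of the linear entropy E_L(U(ψ_A ⊗ ψ_B)) over independent unit vectors ψ_A, ψ_B in ℂ^N, each distributed according to the unitarily invariant (Fubini–Study) measure on the unit sphere of ℂ^N, equals (N²/(N+1)²)·[E(U) + E(US) − E(S)], where E(S) = (N²−1)/N². -/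
open Matrix MeasureTheory
open scoped Kronecker

noncomputable section

/-- The reduced density matrix `ρ_A = tr_B |ψ⟩⟨ψ|` of a vector `ψ ∈ ℂ^N ⊗ ℂ^N`. -/
def redA (N : ℕ) (ψ : Fin N × Fin N → ℂ) : Matrix (Fin N) (Fin N) ℂ :=
  Matrix.of fun i i' => ∑ α, ψ (i, α) * (starRingEnd ℂ) (ψ (i', α))

/-- The linear entropy `E_L(ψ) = 1 - tr(ρ_A²)`. -/
def linEnt (N : ℕ) (ψ : Fin N × Fin N → ℂ) : ℝ :=
  1 - ((redA N ψ * redA N ψ).trace).re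

theorem one_add_smul_mem_unitaryGroup {n : Type*} [Fintype n] [DecidableEq n]
    {P : Matrix n n ℂ} (hP : Pᴴ = P) (hPP : P * P = P) :
    1 + (Complex.I - 1) • P ∈ Matrix.unitaryGroup n ℂ := by
  rw [Matrix.mem_unitaryGroup_iff, Matrix.star_eq_conjTranspose]
  have hI : (Complex.I - 1) * (-Complex.I - 1) = 2 := by
    linear_combination -Complex.I_mul_I
  simp only [conjTranspose_add, conjTranspose_one, conjTranspose_smul, hP, star_sub, star_one,
    Complex.star_def, Complex.conj_I, add_mul, mul_add, one_mul, mul_one, smul_mul_smul_comm, hPP,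
    hI]
  module

theorem continuous_unitaryGroup_apply {n : Type*} [Fintype n] [DecidableEq n] (i c : n) :
    Continuous fun g : Matrix.unitaryGroup n ℂ => (g : Matrix n n ℂ) i c :=
  continuous_subtype_val.matrix_elem i c

/-- The degree `(2,2)` monomial in the entries of the column `c` of a unitary matrix. -/
def colMonomial {n : Type*} [Fintype n] [DecidableEq n] (c i j k l : n)
    (g : Matrix.unitaryGroup n ℂ) : ℂ :=
  (g : Matrix n n ℂ) i c * star ((g : Matrix n n ℂ) j c) *
    (g : Matrix n n ℂ) k c * star ((g : Matrix n n ℂ) l c)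

section Moments

variable {n : Type*} [Fintype n] [DecidableEq n]
  (μ : Measure (Matrix.unitaryGroup n ℂ))

theorem integrable_colMonomial [IsProbabilityMeasure μ] (c i j k l : n) :
    Integrable (colMonomial c i j k l) μ := by
  have hc : Continuous (colMonomial c i j k l) := by
    unfold colMonomial
    have h := fun m => continuous_unitaryGroup_apply m c
    exact (((h i).mul (h j).star).mul (h k)).mul (h l).star
  refine Integrable.of_bound hc.measurable.aestronglyMeasurable 1
    (Filter.Eventually.of_forall fun g => ?_)
  have h := fun m => entry_norm_bound_of_unitary g.2 m c
  simp only [colMonomial, norm_mul, norm_star]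
  exact mul_le_one₀ (mul_le_one₀ (mul_le_one₀ (h i) (norm_nonneg _) (h j)) (norm_nonneg _) (h k))
    (norm_nonneg _) (h l)

variable [μ.IsHaarMeasure]

theorem integral_colMonomial_mul (V : Matrix.unitaryGroup n ℂ) (c i j k l : n) :
    ∫ g, colMonomial c i j k l (V * g) ∂μ = ∫ g, colMonomial c i j k l g ∂μ :=
  integral_mul_left_eq_self (colMonomial c i j k l) V

theorem integral_colMonomial_eq_zero (c i j k l : n) (h₁ : ¬(i = j ∧ k = l))
    (h₂ : ¬(i = l ∧ k = j)) : ∫ g, colMonomial c i j k l g ∂μ = 0 := by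
  by_contra hne
  let z : n → n → ℂ := fun m i => if i = m then Complex.I else 1
  have key (m : n) : z m i * star (z m j) * z m k * star (z m l) = 1 := by
    have hV := one_add_smul_mem_unitaryGroup (P := Matrix.single m m (1 : ℂ)) (by simp) (by simp)
    have hr (g : Matrix.unitaryGroup n ℂ) (i : n) :
        ((⟨_, hV⟩ * g : Matrix.unitaryGroup n ℂ) : Matrix n n ℂ) i c =
          z m i * (g : Matrix n n ℂ) i c := by
      by_cases him : i = m
      · subst him
        simp [z, add_mul]
        ring
      · simp [z, add_mul, him]
    have := integral_colMonomial_mul μ ⟨_, hV⟩ c i j k l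
    simp only [colMonomial, hr] at this
    refine mul_right_cancel₀ hne ?_
    rw [one_mul, ← integral_const_mul]
    refine Eq.trans (integral_congr_ae (.of_forall fun g => ?_)) this
    simp only [colMonomial, star_mul']
    ring
  have hi := key i
  have hj := key j
  have hk := key k
  have hl := key l
  have hI := Complex.I_mul_I
  have e2 : Complex.I ≠ 1 := fun h => by simpa using congrArg Complex.re h
  have e3 : -Complex.I ≠ 1 := fun h => by simpa using congrArg Complex.re h
  have e4 : (-1 : ℂ) ≠ 1 := by norm_num
  simp only [z, apply_ite star, star_one, Complex.star_def, Complex.conj_I, if_true] at hi hj hk hl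
  by_cases ij : i = j <;> by_cases kl : k = l <;> by_cases il : i = l <;> grind

theorem integral_colMonomial_self [IsProbabilityMeasure μ] (c : n) {i j : n} (hij : i ≠ j) :
    4 * ∫ g, colMonomial c i i i i g ∂μ = ∫ g, colMonomial c i i i i g ∂μ +
      ∫ g, colMonomial c j j j j g ∂μ + 4 * ∫ g, colMonomial c i i j j g ∂μ := by
  have hjj := hij.symm
  let P : Matrix n n ℂ := (2⁻¹ : ℂ) •
    (Matrix.single i i 1 + Matrix.single i j 1 + Matrix.single j i 1 + Matrix.single j j 1)
  have hP : Pᴴ = P := by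
    simp [P]
    abel
  have hPP : P * P = P := by
    simp only [P, smul_mul_smul_comm, mul_add, add_mul, Matrix.single_mul_single_same,
      Matrix.single_mul_single_of_ne _ _ _ _ hij, Matrix.single_mul_single_of_ne _ _ _ _ hjj, mul_one]
    module
  have hV := one_add_smul_mem_unitaryGroup hP hPP
  have hr (g : Matrix.unitaryGroup n ℂ) :
      ((⟨_, hV⟩ * g : Matrix.unitaryGroup n ℂ) : Matrix n n ℂ) i c =
        2⁻¹ * ((1 + Complex.I) * (g : Matrix n n ℂ) i c +
          (Complex.I - 1) * (g : Matrix n n ℂ) j c) := by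
    simp [P, add_mul, hij, mul_add]
    ring
  have h := integral_colMonomial_mul μ ⟨_, hV⟩ c i i i i
  have expand (g : Matrix.unitaryGroup n ℂ) : colMonomial c i i i i (⟨_, hV⟩ * g) =
      4⁻¹ * (colMonomial c i i i i g + colMonomial c j j j j g + 4 * colMonomial c i i j j g
        - 2 * Complex.I * (colMonomial c i j i i g + colMonomial c i j j j g)
        + 2 * Complex.I * (colMonomial c j i i i g + colMonomial c j i j j g)
        - colMonomial c i j i j g - colMonomial c j i j i g) := by
    simp only [colMonomial, hr, star_mul', star_add, star_sub, Complex.star_def, Complex.conj_I,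
      map_inv₀, map_ofNat, map_one]
    grind [Complex.I_mul_I]
  have int := integrable_colMonomial μ c
  simp_rw [expand] at h
  rw [integral_const_mul, integral_sub (by fun_prop) (by fun_prop),
    integral_sub (by fun_prop) (by fun_prop), integral_add (by fun_prop) (by fun_prop),
    integral_sub (by fun_prop) (by fun_prop), integral_add (by fun_prop) (by fun_prop),
    integral_add (by fun_prop) (by fun_prop),
    integral_const_mul, integral_const_mul, integral_const_mul,
    integral_add (by fun_prop) (by fun_prop), integral_add (by fun_prop) (by fun_prop)] at h
  rw [integral_colMonomial_eq_zero μ c i j i i, integral_colMonomial_eq_zero μ c i j j j,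
    integral_colMonomial_eq_zero μ c j i i i, integral_colMonomial_eq_zero μ c j i j j,
    integral_colMonomial_eq_zero μ c i j i j, integral_colMonomial_eq_zero μ c j i j i] at h
  · linear_combination -4 * h
  all_goals simp [hij, hjj]

theorem integral_colMonomial [IsProbabilityMeasure μ] (c i j k l : n) :
    ∫ g, colMonomial c i j k l g ∂μ = ((Fintype.card n : ℂ) * (Fintype.card n + 1))⁻¹ *
      ((1 : Matrix n n ℂ) i j * (1 : Matrix n n ℂ) k l +
        (1 : Matrix n n ℂ) i l * (1 : Matrix n n ℂ) k j) := by
  let A : ℂ := ∫ g, colMonomial c c c c c g ∂μ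
  have swap (i j k l : n) : colMonomial c i l k j = colMonomial c i j k l := by
    funext g
    simp only [colMonomial]
    ring
  have diag (i : n) : ∫ g, colMonomial c i i i i g ∂μ = A := by
    rcases eq_or_ne i c with rfl | h
    · rfl
    · have h₁ := integral_colMonomial_self μ c h
      have h₂ := integral_colMonomial_self μ c h.symm
      have h₃ : colMonomial c c c i i = colMonomial c i i c c := by
        funext g
        simp only [colMonomial]
        ring
      rw [h₃] at h₂
      linear_combination 4⁻¹ * h₁ - 4⁻¹ * h₂
  have off {i j : n} (h : i ≠ j) : ∫ g, colMonomial c i i j j g ∂μ = A / 2 := by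
    have h₁ := integral_colMonomial_self μ c h
    rw [diag, diag] at h₁
    linear_combination - 4⁻¹ * h₁
  have pair (i j : n) : ∫ g, colMonomial c i i j j g ∂μ =
      A / 2 * (1 + (1 : Matrix n n ℂ) i j) := by
    rcases eq_or_ne i j with rfl | h
    · simp [diag]
      ring
    · simp [off h, h]
  have col (g : Matrix.unitaryGroup n ℂ) :
      ∑ i, (g : Matrix n n ℂ) i c * star ((g : Matrix n n ℂ) i c) = 1 := by
    have := congrFun (congrFun (Matrix.mem_unitaryGroup_iff'.mp g.2) c) c
    simpa [Matrix.mul_apply, mul_comm] using this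
  have total : ∑ i, ∑ j, ∫ g, colMonomial c i i j j g ∂μ = 1 := by
    simp_rw [← integral_finsetSum _ fun j _ => integrable_colMonomial μ c _ _ j _]
    rw [← integral_finsetSum _ fun i _ => integrable_finsetSum _ fun j _ =>
      integrable_colMonomial μ c _ _ _ _]
    have (g : Matrix.unitaryGroup n ℂ) : ∑ i, ∑ j, colMonomial c i i j j g = 1 := by
      rw [← one_mul (1 : ℂ), ← col g, Finset.sum_mul_sum]
      simp only [colMonomial, mul_assoc]
    simp [this]
  have hN : (Fintype.card n : ℂ) ≠ 0 := by
    have : Nonempty n := ⟨c⟩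
    exact_mod_cast Fintype.card_ne_zero
  have hN' : (Fintype.card n : ℂ) + 1 ≠ 0 := Nat.cast_add_one_ne_zero _
  have hA : A / 2 = ((Fintype.card n : ℂ) * (Fintype.card n + 1))⁻¹ := by
    simp only [pair, ← Finset.mul_sum, Finset.sum_add_distrib, Matrix.one_apply] at total
    simp at total
    field_simp
    linear_combination 2 * total
  by_cases h₁ : i = j ∧ k = l
  · obtain ⟨rfl, rfl⟩ := h₁
    rw [pair, hA]
    simp only [Matrix.one_apply]
    grind
  by_cases h₂ : i = l ∧ k = j
  · obtain ⟨rfl, rfl⟩ := h₂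
    rw [swap, pair, hA]
    simp only [Matrix.one_apply]
    grind
  rw [integral_colMonomial_eq_zero μ c i j k l h₁ h₂]
  simp only [Matrix.one_apply, mul_ite, mul_one, mul_zero]
  grind

end Moments

section Sums

variable {n R : Type*} [Fintype n] [CommSemiring R]

theorem sum_mul_sum_mul_sum_mul_sum (a b c d : n → R) :
    (∑ p, a p) * (∑ q, b q) * (∑ r, c r) * (∑ s, d s) =
      ∑ p, ∑ r, ∑ q, ∑ s, a p * b q * c r * d s := by
  rw [mul_right_comm (∑ p, a p), mul_assoc (_ * _), Finset.sum_mul_sum, Finset.sum_mul_sum]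
  simp_rw [Finset.sum_mul, Finset.mul_sum]
  simp only [mul_assoc, mul_left_comm]

theorem sum_sum_mul_one_apply [DecidableEq n] (G : n × n → n × n → R) (a b a' b' : n) :
    ∑ q, ∑ s, G q s * (((1 : Matrix n n R) a q.1 * (1 : Matrix n n R) b q.2) *
      ((1 : Matrix n n R) a' s.1 * (1 : Matrix n n R) b' s.2)) = G (a, b) (a', b') := by
  have h (a b : n) (F : n × n → R) :
      ∑ q, F q * ((1 : Matrix n n R) a q.1 * (1 : Matrix n n R) b q.2) = F (a, b) := by
    simp [Fintype.sum_prod_type, Matrix.one_apply]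
  calc _ = ∑ q, (∑ s, G q s * ((1 : Matrix n n R) a' s.1 * (1 : Matrix n n R) b' s.2)) *
        ((1 : Matrix n n R) a q.1 * (1 : Matrix n n R) b q.2) := by
        simp only [Finset.sum_mul]
        refine Finset.sum_congr rfl fun q _ => Finset.sum_congr rfl fun s _ => ?_
        ring
    _ = _ := by simp only [h]

end Sums

section Gate

variable {N : ℕ}

/-- The contraction of `U ⊗ U` and its conjugate along the permutation exchanging the two
copies of the first tensor factor. -/
def crossContraction (U : Matrix (Fin N × Fin N) (Fin N × Fin N) ℂ) (w x y z : Fin N × Fin N) :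
    ℂ :=
  ∑ p, ∑ r, U w p * star (U x (r.1, p.2)) * U y r * star (U z (p.1, r.2))

theorem crossContraction_mul_swapGate (U : Matrix (Fin N × Fin N) (Fin N × Fin N) ℂ)
    (w x y z : Fin N × Fin N) : crossContraction (U * swapGate N) w x y z =
      ∑ p, ∑ r, U w p * star (U x (p.1, r.2)) * U y r * star (U z (r.1, p.2)) := by
  have h (w p : Fin N × Fin N) : (U * swapGate N) w p = U w p.swap := by
    simp only [Matrix.mul_apply, swapGate, Matrix.of_apply, mul_ite, mul_one, mul_zero]
    rw [Finset.sum_eq_single p.swap] <;> simp [Prod.ext_iff]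
    grind
  simp only [crossContraction, h, Prod.swap_prod_mk]
  exact Fintype.sum_equiv (Equiv.prodComm _ _) _ _ fun p =>
    Fintype.sum_equiv (Equiv.prodComm _ _) _ _ fun r => rfl

theorem sum_crossContraction (hN : N ≠ 0) (U : Matrix (Fin N × Fin N) (Fin N × Fin N) ℂ) :
    ∑ i, ∑ i', ∑ α, ∑ α', crossContraction U (i, α) (i', α) (i', α') (i, α') =
      (N : ℂ) ^ 4 * (rhoR N U * rhoR N U).trace := by
  have hN' : (N : ℂ) ≠ 0 := Nat.cast_ne_zero.mpr hN
  let e : Fin N × Fin N × Fin N × Fin N × (Fin N × Fin N) × (Fin N × Fin N) ≃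
      (Fin N × Fin N) × (Fin N × Fin N) × (Fin N × Fin N) × (Fin N × Fin N) :=
    { toFun := fun t => ((t.1, t.2.2.2.2.1.1), (t.2.1, t.2.2.2.2.2.1),
        (t.2.2.1, t.2.2.2.2.1.2), (t.2.2.2.1, t.2.2.2.2.2.2))
      invFun := fun t => (t.1.1, t.2.1.1, t.2.2.1.1, t.2.2.2.1, (t.1.2, t.2.2.1.2),
        (t.2.1.2, t.2.2.2.2))
      left_inv := fun _ => rfl
      right_inv := fun _ => rfl }
  let G : (Fin N × Fin N) × (Fin N × Fin N) × (Fin N × Fin N) × (Fin N × Fin N) → ℂ := fun t =>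
    reshuffle N U t.1 t.2.2.1 * star (reshuffle N U t.2.1 t.2.2.1) *
      (reshuffle N U t.2.1 t.2.2.2 * star (reshuffle N U t.1 t.2.2.2))
  calc _ = ∑ t, G (e t) := by
        simp only [Fintype.sum_prod_type, G, e, Equiv.coe_fn_mk, reshuffle,
          crossContraction, Matrix.of_apply, mul_assoc]
    _ = ∑ t, G t := Equiv.sum_comp e G
    _ = ((reshuffle N U * (reshuffle N U)ᴴ) * (reshuffle N U * (reshuffle N U)ᴴ)).trace := by
        rw [Matrix.trace]
        simp only [Matrix.diag_apply, Matrix.mul_apply (M := _ * _),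
          Matrix.mul_apply (M := reshuffle N U), Matrix.conjTranspose_apply, Finset.sum_mul_sum,
          Fintype.sum_prod_type (α₁ := Fin N × Fin N), G]
    _ = _ := by
        rw [rhoR, smul_mul_smul_comm, Matrix.trace_smul, smul_eq_mul]
        field_simp

theorem trace_redA_mul_redA (ψ : Fin N × Fin N → ℂ) : (redA N ψ * redA N ψ).trace =
    ∑ i, ∑ i', ∑ α, ∑ α', ψ (i, α) * star (ψ (i', α)) * ψ (i', α') * star (ψ (i, α')) := by
  simp only [Matrix.trace, Matrix.diag_apply, Matrix.mul_apply, redA, Matrix.of_apply,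
    Finset.sum_mul_sum, starRingEnd_apply, mul_assoc]

theorem sum_mul_star_of_mem_unitaryGroup {n : Type*} [Fintype n] [DecidableEq n]
    {U : Matrix n n ℂ} (hU : U ∈ Matrix.unitaryGroup n ℂ) (x y : n) :
    ∑ p, U x p * star (U y p) = (1 : Matrix n n ℂ) x y := by
  rw [← Matrix.mem_unitaryGroup_iff.mp hU]
  simp [Matrix.mul_apply]

/-- The image under `U` of the product of the columns `c` of two unitary matrices. -/
def productColumn (U : Matrix (Fin N × Fin N) (Fin N × Fin N) ℂ) (c : Fin N)
    (g : Matrix.unitaryGroup (Fin N) ℂ × Matrix.unitaryGroup (Fin N) ℂ) : Fin N × Fin N → ℂ :=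
  U.mulVec fun p =>
    (g.1 : Matrix (Fin N) (Fin N) ℂ) p.1 c * (g.2 : Matrix (Fin N) (Fin N) ℂ) p.2 c

theorem productColumn_monomial (U : Matrix (Fin N × Fin N) (Fin N × Fin N) ℂ) (c : Fin N)
    (w x y z : Fin N × Fin N)
    (g : Matrix.unitaryGroup (Fin N) ℂ × Matrix.unitaryGroup (Fin N) ℂ) :
    productColumn U c g w * star (productColumn U c g x) * productColumn U c g y *
        star (productColumn U c g z) =
      ∑ p, ∑ r, ∑ q, ∑ s, U w p * star (U x q) * U y r * star (U z s) *
        (colMonomial c p.1 q.1 r.1 s.1 g.1 * colMonomial c p.2 q.2 r.2 s.2 g.2) := by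
  simp only [productColumn, Matrix.mulVec, dotProduct, star_sum, sum_mul_sum_mul_sum_mul_sum]
  refine Finset.sum_congr rfl fun p _ => Finset.sum_congr rfl fun r _ =>
    Finset.sum_congr rfl fun q _ => Finset.sum_congr rfl fun s _ => ?_
  simp only [colMonomial, star_mul']
  ring

variable (μ : Measure (Matrix.unitaryGroup (Fin N) ℂ)) [IsProbabilityMeasure μ]

theorem integrable_productColumn_monomial
    (U : Matrix (Fin N × Fin N) (Fin N × Fin N) ℂ) (c : Fin N) (w x y z : Fin N × Fin N) :
    Integrable (fun g => productColumn U c g w * star (productColumn U c g x) *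
      productColumn U c g y * star (productColumn U c g z)) (μ.prod μ) := by
  simp only [productColumn_monomial]
  refine integrable_finsetSum _ fun p _ => integrable_finsetSum _ fun r _ =>
    integrable_finsetSum _ fun q _ => integrable_finsetSum _ fun s _ => ?_
  exact ((integrable_colMonomial μ c _ _ _ _).mul_prod
    (integrable_colMonomial μ c _ _ _ _)).const_mul _

theorem integral_productColumn_monomial [μ.IsHaarMeasure]
    {U : Matrix (Fin N × Fin N) (Fin N × Fin N) ℂ}
    (hU : U ∈ Matrix.unitaryGroup (Fin N × Fin N) ℂ) (c : Fin N) (w x y z : Fin N × Fin N) :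
    ∫ g, productColumn U c g w * star (productColumn U c g x) *
        productColumn U c g y * star (productColumn U c g z) ∂(μ.prod μ) =
      (((N : ℂ) * (N + 1))⁻¹) ^ 2 *
        ((1 : Matrix (Fin N × Fin N) (Fin N × Fin N) ℂ) w x *
            (1 : Matrix (Fin N × Fin N) (Fin N × Fin N) ℂ) y z +
          (1 : Matrix (Fin N × Fin N) (Fin N × Fin N) ℂ) w z *
            (1 : Matrix (Fin N × Fin N) (Fin N × Fin N) ℂ) y x +
          crossContraction U w x y z + crossContraction (U * swapGate N) w x y z) := by
  have int (p q r s : Fin N × Fin N) : Integrable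
      (fun g : Matrix.unitaryGroup (Fin N) ℂ × Matrix.unitaryGroup (Fin N) ℂ =>
        U w p * star (U x q) * U y r * star (U z s) *
          (colMonomial c p.1 q.1 r.1 s.1 g.1 * colMonomial c p.2 q.2 r.2 s.2 g.2)) (μ.prod μ) :=
    ((integrable_colMonomial μ c _ _ _ _).mul_prod
      (integrable_colMonomial μ c _ _ _ _)).const_mul _
  let F (p r q s : Fin N × Fin N) : ℂ := U w p * star (U x q) * U y r * star (U z s)
  let K (a b : Fin N × Fin N) (q s : Fin N × Fin N) : ℂ :=
    ((1 : Matrix (Fin N) (Fin N) ℂ) a.1 q.1 * (1 : Matrix (Fin N) (Fin N) ℂ) a.2 q.2) *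
      ((1 : Matrix (Fin N) (Fin N) ℂ) b.1 s.1 * (1 : Matrix (Fin N) (Fin N) ℂ) b.2 s.2)
  have hK (p r a b : Fin N × Fin N) : ∑ q, ∑ s, F p r q s * K a b q s = F p r a b :=
    sum_sum_mul_one_apply (F p r) a.1 a.2 b.1 b.2
  calc _ = ∑ p, ∑ r, ∑ q, ∑ s, F p r q s *
        ((∫ g, colMonomial c p.1 q.1 r.1 s.1 g ∂μ) *
          ∫ g, colMonomial c p.2 q.2 r.2 s.2 g ∂μ) := by
        simp only [productColumn_monomial]
        rw [integral_finsetSum _ fun p _ => integrable_finsetSum _ fun r _ =>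
          integrable_finsetSum _ fun q _ => integrable_finsetSum _ fun s _ => int p q r s]
        refine Finset.sum_congr rfl fun p _ => ?_
        rw [integral_finsetSum _ fun r _ =>
          integrable_finsetSum _ fun q _ => integrable_finsetSum _ fun s _ => int p q r s]
        refine Finset.sum_congr rfl fun r _ => ?_
        rw [integral_finsetSum _ fun q _ => integrable_finsetSum _ fun s _ => int p q r s]
        refine Finset.sum_congr rfl fun q _ => ?_
        rw [integral_finsetSum _ fun s _ => int p q r s]
        refine Finset.sum_congr rfl fun s _ => ?_
        rw [integral_const_mul, integral_prod_mul]
    _ = ∑ p, ∑ r, ∑ q, ∑ s, (((N : ℂ) * (N + 1))⁻¹) ^ 2 * (F p r q s * K p r q s +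
          F p r q s * K r p q s + F p r q s * K (r.1, p.2) (p.1, r.2) q s +
          F p r q s * K (p.1, r.2) (r.1, p.2) q s) := by
        refine Finset.sum_congr rfl fun p _ => Finset.sum_congr rfl fun r _ =>
          Finset.sum_congr rfl fun q _ => Finset.sum_congr rfl fun s _ => ?_
        rw [integral_colMonomial, integral_colMonomial, Fintype.card_fin]
        ring
    _ = (((N : ℂ) * (N + 1))⁻¹) ^ 2 * ((∑ p, ∑ r, F p r p r) + (∑ p, ∑ r, F p r r p) +
          (∑ p, ∑ r, F p r (r.1, p.2) (p.1, r.2)) +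
          ∑ p, ∑ r, F p r (p.1, r.2) (r.1, p.2)) := by
        simp only [← Finset.mul_sum, Finset.sum_add_distrib, hK]
    _ = _ := by
        rw [crossContraction_mul_swapGate, crossContraction]
        simp only [← sum_mul_star_of_mem_unitaryGroup hU, Finset.sum_mul_sum]
        congr 4
        · simp only [F, mul_assoc]
        · refine Finset.sum_congr rfl fun p _ => Finset.sum_congr rfl fun r _ => ?_
          simp only [F]
          ring

theorem integrable_trace_redA_productColumn
    (U : Matrix (Fin N × Fin N) (Fin N × Fin N) ℂ) (c : Fin N) :
    Integrable (fun g => (redA N (productColumn U c g) * redA N (productColumn U c g)).trace)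
      (μ.prod μ) := by
  simp only [trace_redA_mul_redA]
  exact integrable_finsetSum _ fun i _ => integrable_finsetSum _ fun i' _ =>
    integrable_finsetSum _ fun α _ => integrable_finsetSum _ fun α' _ =>
    integrable_productColumn_monomial μ U c _ _ _ _

theorem integral_trace_redA_productColumn [μ.IsHaarMeasure]
    {U : Matrix (Fin N × Fin N) (Fin N × Fin N) ℂ}
    (hU : U ∈ Matrix.unitaryGroup (Fin N × Fin N) ℂ) (c : Fin N) :
    ∫ g, (redA N (productColumn U c g) * redA N (productColumn U c g)).trace ∂(μ.prod μ) =
      (((N : ℂ) * (N + 1))⁻¹) ^ 2 * (2 * N ^ 3 + N ^ 4 * (rhoR N U * rhoR N U).trace +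
        N ^ 4 * (rhoR N (U * swapGate N) * rhoR N (U * swapGate N)).trace) := by
  have hN : N ≠ 0 := by
    rintro rfl
    exact c.elim0
  have int := integrable_productColumn_monomial μ U c
  simp only [trace_redA_mul_redA]
  rw [integral_finsetSum _ fun i _ => integrable_finsetSum _ fun i' _ =>
    integrable_finsetSum _ fun α _ => integrable_finsetSum _ fun α' _ => int _ _ _ _]
  simp_rw [integral_finsetSum _ fun i' _ => integrable_finsetSum _ fun α _ =>
    integrable_finsetSum _ fun α' _ => int (_, α) (i', α) (i', α') (_, α'),
    integral_finsetSum _ fun α _ => integrable_finsetSum _ fun α' _ =>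
      int (_, α) (_, α) (_, α') (_, α'),
    integral_finsetSum _ fun α' _ => int (_, _) (_, _) (_, α') (_, α'),
    integral_productColumn_monomial μ hU, ← Finset.mul_sum, Finset.sum_add_distrib,
    sum_crossContraction hN]
  congr 1
  simp [Matrix.one_apply]
  ring

end Gate

/-- The average of the linear entropy `E_L(U(ψ_A ⊗ ψ_B))` over
independent Fubini–Study random unit vectors `ψ_A = V_A e₁`, `ψ_B = V_B e₁` (with
`V_A, V_B` Haar on `U(N)`) equals `(N²/(N+1)²)(E(U) + E(US) - E(S))`, where
`E(U) = 1 - X(U)`, `E(US) = 1 - X(US)` and `E(S) = (N²-1)/N²`. -/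
theorem entangling_power_is_average_linear_entropy (N : ℕ) (hN : 2 ≤ N)
    (U : Matrix (Fin N × Fin N) (Fin N × Fin N) ℂ)
    (hU : U ∈ Matrix.unitaryGroup (Fin N × Fin N) ℂ)
    (μ : Measure (Matrix.unitaryGroup (Fin N) ℂ)) [μ.IsHaarMeasure] [IsProbabilityMeasure μ] :
    (∫ g : Matrix.unitaryGroup (Fin N) ℂ × Matrix.unitaryGroup (Fin N) ℂ,
        linEnt N (U.mulVec fun p =>
          (g.1 : Matrix (Fin N) (Fin N) ℂ) p.1 (⟨0, by omega⟩ : Fin N) *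
          (g.2 : Matrix (Fin N) (Fin N) ℂ) p.2 (⟨0, by omega⟩ : Fin N)) ∂(μ.prod μ))
      = ((N : ℝ) ^ 2 / ((N : ℝ) + 1) ^ 2) *
          ((1 - Xpur N U) + (1 - Xpur N (U * swapGate N)) - ((N : ℝ) ^ 2 - 1) / (N : ℝ) ^ 2) := by
  have int := integrable_trace_redA_productColumn μ U ⟨0, by omega⟩
  have h := integral_trace_redA_productColumn μ hU ⟨0, by omega⟩
  change ∫ g, 1 - RCLike.re (redA N (productColumn U ⟨0, _⟩ g) *
    redA N (productColumn U ⟨0, _⟩ g)).trace ∂(μ.prod μ) = _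
  rw [integral_sub (integrable_const _) int.re, integral_re int, h]
  have hN' : (N : ℝ) ≠ 0 := by positivity
  have hre (t t' : ℂ) : ((((N : ℂ) * (N + 1))⁻¹) ^ 2 * (2 * N ^ 3 + N ^ 4 * t + N ^ 4 * t')).re =
      (((N : ℝ) * (N + 1))⁻¹) ^ 2 * (2 * N ^ 3 + N ^ 4 * t.re + N ^ 4 * t'.re) := by
    have : (((N : ℂ) * (N + 1))⁻¹) ^ 2 = (((((N : ℝ) * (N + 1))⁻¹) ^ 2 : ℝ) : ℂ) := by
      push_cast
      rfl
    rw [this, Complex.re_ofReal_mul]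
    congr 1
    have h4 : (N : ℂ) ^ 4 = (((N : ℝ) ^ 4 : ℝ) : ℂ) := by
      push_cast
      rfl
    have h3 : 2 * (N : ℂ) ^ 3 = ((2 * (N : ℝ) ^ 3 : ℝ) : ℂ) := by
      push_cast
      rfl
    rw [h3, h4, Complex.add_re, Complex.add_re, Complex.re_ofReal_mul, Complex.re_ofReal_mul,
      Complex.ofReal_re]
  rw [RCLike.re_to_complex, hre, ← Xpur, ← Xpur]
  simp only [integral_const, probReal_univ, smul_eq_mul, mul_one]
  field_simp
  ring
end
end
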